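/- Let α, β > 1, c ∈ ℝ, and f ∈ 𝒮(ℝ²) with f(x+c,y) = f(-x+c,y) = f(x+c,-y), f(x+c,0) = 0, and (∂^k f/∂x^k)(c,y)=0 for k=0,…,m, m ≥ α - 2. Define R_{α,β} f(s,u) = ∫_{{x : s|x-c|^α + u > 0}} f(x, (s|x-c|^α+u)^{1/β})/(s|x-c|^α+u)^{1/β} dx. Then for all (x,y) with x ≠ c and y ≠ 0: f(x,y) = (α|x-c|^{α-1}|y|/(4π²)) ∫_ℝ ( p.v. ∫_ℝ (∂_u R_{α,β} f)(s,u)/(|y|^β - s|x-c|^α - u) du ) ds. -/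

import Mathlib

open MeasureTheory Filter

/-- The Cauchy principal value of `∫ g` around the singular point `a`. -/
noncomputable def pv (g : ℝ → ℝ) (a : ℝ) : ℝ :=
  limUnder (nhdsWithin 0 (Set.Ioi 0)) (fun ε : ℝ => ∫ v in {v : ℝ | ε < |v - a|}, g v)

section

open scoped Topology LineDeriv SchwartzMap ContDiff

/-- The symmetric second difference of `g` at `a` with step `w`. -/
noncomputable def secDiff (g : ℝ → ℝ) (a w : ℝ) : ℝ := g (a + w) + g (a - w) - 2 * g a

/-- `h` and its first two derivatives on `(0, ∞)` are bounded like those of `C * x ^ e`. -/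
def SymbolBound (e C : ℝ) (h : ℝ → ℝ) : Prop :=
  ∀ x > 0, DifferentiableAt ℝ h x ∧ DifferentiableAt ℝ (deriv h) x ∧ |h x| ≤ C * x ^ e ∧
    |deriv h x| ≤ C * x ^ (e - 1) ∧ |deriv (deriv h) x| ≤ C * x ^ (e - 2)

lemma SymbolBound.const_nonneg {e C : ℝ} {h : ℝ → ℝ} (H : SymbolBound e C h) : 0 ≤ C := by
  have := (H 1 one_pos).2.2.1
  simp only [Real.one_rpow, mul_one] at this
  exact (abs_nonneg _).trans this

lemma secDiff_neg (g : ℝ → ℝ) (a w : ℝ) : secDiff g a (-w) = secDiff g a w := by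
  simp only [secDiff, sub_neg_eq_add, ← sub_eq_add_neg]; ring

lemma abs_secDiff_le_of_deriv2 {h : ℝ → ℝ} {a w S : ℝ} (hw : 0 ≤ w)
    (h1 : ∀ x ∈ Set.Icc (a - w) (a + w), DifferentiableAt ℝ h x)
    (h2 : ∀ x ∈ Set.Icc (a - w) (a + w), DifferentiableAt ℝ (deriv h) x)
    (hS : ∀ x ∈ Set.Icc (a - w) (a + w), |deriv (deriv h) x| ≤ S) :
    |secDiff h a w| ≤ 2 * S * w ^ 2 := by
  have hS0 : 0 ≤ S := (abs_nonneg _).trans (hS a ⟨by linarith, by linarith⟩)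
  have key : ∀ r ∈ Set.Icc 0 w, |deriv h (a + r) - deriv h (a - r)| ≤ 2 * S * w := by
    intro r hr
    have := (convex_Icc (a - w) (a + w)).norm_image_sub_le_of_norm_deriv_le (𝕜 := ℝ)
      (f := deriv h) (C := S) h2 hS (x := a - r) (y := a + r)
      ⟨by linarith [hr.2], by linarith [hr.1, hr.2]⟩ ⟨by linarith [hr.1, hr.2], by linarith [hr.2]⟩
    simp only [Real.norm_eq_abs] at this
    refine this.trans ?_
    rw [show a + r - (a - r) = 2 * r by ring, abs_of_nonneg (by linarith [hr.1])]
    nlinarith [hr.2]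
  have hd : ∀ r ∈ Set.Icc 0 w, HasDerivWithinAt (fun r => h (a + r) + h (a - r))
      (deriv h (a + r) - deriv h (a - r)) (Set.Icc 0 w) r := by
    intro r hr
    have e1 := (h1 (a + r) ⟨by linarith [hr.1], by linarith [hr.2]⟩).hasDerivAt.comp_const_add a r
    have e2 := (h1 (a - r) ⟨by linarith [hr.2], by linarith [hr.1]⟩).hasDerivAt.comp_const_sub a r
    exact ((e1.add e2).congr_deriv (by ring)).hasDerivWithinAt
  have := (convex_Icc 0 w).norm_image_sub_le_of_norm_hasDerivWithin_le (𝕜 := ℝ) hd key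
    (x := 0) (y := w) ⟨le_rfl, hw⟩ ⟨hw, le_rfl⟩
  simp only [Real.norm_eq_abs, add_zero, sub_zero, abs_of_nonneg hw] at this
  unfold secDiff
  rw [show h (a + w) + h (a - w) - 2 * h a = h (a + w) + h (a - w) - (h a + h a) by ring]
  exact this.trans (by nlinarith)

lemma abs_secDiff_le_of_symbolBound {h : ℝ → ℝ} {e C : ℝ} (he0 : 0 ≤ e) (he1 : e < 1)
    (H : SymbolBound e C h) (hz : ∀ x ≤ 0, h x = 0) {w : ℝ} (hw : 0 < w) (z : ℝ) :
    |secDiff h z w| ≤ 108 * C * (w ^ 2 * (w + |z|) ^ (e - 2)) := by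
  have hC := H.const_nonneg
  have hwz : 0 < w + |z| := by positivity
  rcases le_or_gt (2 * w) z with h1 | h1
  · have hz0 : 0 < z := by linarith
    have hzw : 0 < z - w := by linarith
    have hb : (z - w) ^ (e - 2) ≤ 9 * (w + |z|) ^ (e - 2) := by
      have : (z - w) ^ (e - 2) ≤ ((w + |z|) / 3) ^ (e - 2) := by
        apply Real.rpow_le_rpow_of_nonpos (by positivity) _ (by linarith)
        rw [abs_of_pos hz0]; linarith
      refine this.trans ?_
      rw [Real.div_rpow hwz.le (by norm_num), div_eq_mul_inv, mul_comm]
      gcongr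
      rw [← Real.rpow_neg (by norm_num)]
      calc (3 : ℝ) ^ (-(e - 2)) ≤ 3 ^ (2 : ℝ) := by
            apply Real.rpow_le_rpow_of_exponent_le <;> linarith
        _ = 9 := by norm_num
    have := abs_secDiff_le_of_deriv2 (h := h) (a := z) (w := w) (S := C * (z - w) ^ (e - 2)) hw.le
      (fun x hx => (H x (hzw.trans_le hx.1)).1) (fun x hx => (H x (hzw.trans_le hx.1)).2.1)
      (fun x hx => (H x (hzw.trans_le hx.1)).2.2.2.2.trans (mul_le_mul_of_nonneg_left
        (Real.rpow_le_rpow_of_nonpos hzw hx.1 (by linarith)) hC))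
    refine this.trans ?_
    calc 2 * (C * (z - w) ^ (e - 2)) * w ^ 2
        ≤ 2 * (C * (9 * (w + |z|) ^ (e - 2))) * w ^ 2 := by gcongr
      _ = 18 * C * (w ^ 2 * (w + |z|) ^ (e - 2)) := by ring
      _ ≤ _ := by gcongr; norm_num
  · rcases le_or_gt z (-(2 * w)) with h2 | h2
    · unfold secDiff
      rw [hz _ (by linarith), hz _ (by linarith), hz _ (by linarith)]
      simp only [add_zero, mul_zero, sub_zero, abs_zero]; positivity
    have hb : ∀ x ≤ 3 * w, |h x| ≤ C * (3 * w ^ e) := by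
      intro x hx
      rcases le_or_gt x 0 with hx0 | hx0
      · rw [hz x hx0, abs_zero]; positivity
      refine (H x hx0).2.2.1.trans ?_
      gcongr
      calc x ^ e ≤ (3 * w) ^ e := by gcongr
        _ = 3 ^ e * w ^ e := Real.mul_rpow (by norm_num) hw.le
        _ ≤ 3 ^ (1 : ℝ) * w ^ e := by gcongr; linarith
        _ = _ := by norm_num
    have hl : w ^ e ≤ 9 * (w ^ 2 * (w + |z|) ^ (e - 2)) := by
      have : (3 * w) ^ (e - 2) ≤ (w + |z|) ^ (e - 2) := by
        apply Real.rpow_le_rpow_of_nonpos hwz _ (by linarith)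
        have : |z| ≤ 2 * w := abs_le.2 ⟨by linarith, by linarith⟩
        linarith
      calc w ^ e = 9 * (w ^ 2 * (9⁻¹ * w ^ (e - 2))) := by
            rw [Real.rpow_sub hw, Real.rpow_two]; field_simp
        _ ≤ 9 * (w ^ 2 * (3 ^ (e - 2) * w ^ (e - 2))) := by
            gcongr
            calc (9 : ℝ)⁻¹ = 3 ^ (-2 : ℝ) := by
                  rw [Real.rpow_neg (by norm_num), Real.rpow_two]; norm_num
              _ ≤ _ := by apply Real.rpow_le_rpow_of_exponent_le <;> linarith
        _ = 9 * (w ^ 2 * (3 * w) ^ (e - 2)) := by rw [Real.mul_rpow (by norm_num) hw.le]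
        _ ≤ _ := by gcongr
    have hzw := hb (z + w) (by linarith)
    have hzw' := hb (z - w) (by linarith)
    have hzz := hb z (by linarith)
    calc |secDiff h z w| ≤ 12 * (C * w ^ e) := by
          unfold secDiff; rw [abs_le] at *; constructor <;> linarith
      _ ≤ 12 * (C * (9 * (w ^ 2 * (w + |z|) ^ (e - 2)))) := by gcongr
      _ = _ := by ring

/-- The integral of `F` over the line `{z = s * t + u}`, parametrized by `t`. -/
noncomputable def lineInt (F : ℝ → ℝ → ℝ) (s u : ℝ) : ℝ := ∫ t, F t (s * t + u)

lemma integrable_inv_one_add_abs_sq : Integrable (fun t : ℝ => ((1 + |t|) ^ 2)⁻¹) := by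
  have := integrable_one_add_norm (E := ℝ) (μ := volume) (r := 2) (by simp)
  refine this.congr (ae_of_all _ fun t => ?_)
  simp only [Real.norm_eq_abs]
  rw [Real.rpow_neg (by positivity), Real.rpow_two]

lemma integrable_line_of_bound {F : ℝ → ℝ → ℝ} {C : ℝ} (hm : Measurable (Function.uncurry F))
    (hb : ∀ t z, |F t z| ≤ C * ((1 + |t|) ^ 2)⁻¹) (s u : ℝ) :
    Integrable (fun t => F t (s * t + u)) := by
  refine (integrable_inv_one_add_abs_sq.const_mul C).mono' ?_ (ae_of_all _ fun t => hb _ _)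
  exact (hm.comp (f := fun t : ℝ => (t, s * t + u)) (by fun_prop)).aestronglyMeasurable

lemma abs_lineInt_le {F : ℝ → ℝ → ℝ} {C : ℝ}
    (hb : ∀ t z, |F t z| ≤ C * ((1 + |t|) ^ 2)⁻¹) (s u : ℝ) :
    |lineInt F s u| ≤ C * ∫ t : ℝ, ((1 + |t|) ^ 2)⁻¹ := by
  rw [← integral_const_mul]
  exact norm_integral_le_of_norm_le (f := fun t => F t (s * t + u))
    (integrable_inv_one_add_abs_sq.const_mul C) (ae_of_all _ fun t => hb _ _)

lemma lineInt_swap (F : ℝ → ℝ → ℝ) {s : ℝ} (hs : s ≠ 0) (u : ℝ) :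
    lineInt F s u = |s⁻¹| * lineInt (fun z t => F t z) s⁻¹ (-(s⁻¹ * u)) := by
  unfold lineInt
  have h1 := integral_add_right_eq_self (μ := volume) (fun z : ℝ => F (s⁻¹ * z + -(s⁻¹ * u)) z) u
  have h2 := Measure.integral_comp_mul_left
    (fun z : ℝ => F (s⁻¹ * (z + u) + -(s⁻¹ * u)) (z + u)) s
  rw [← h1]
  simp only [smul_eq_mul] at h2
  rw [← h2]
  congr 1; ext t
  congr 1
  field_simp; ring

lemma integrable_and_integral_scaled {e : ℝ} (he : e < 1) {w k c : ℝ} (hw : 0 < w) (hk : k ≠ 0) :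
    Integrable (fun t : ℝ => w ^ 2 * (w + |k * t + c|) ^ (e - 2)) ∧
    ∫ t : ℝ, w ^ 2 * (w + |k * t + c|) ^ (e - 2) =
      |k|⁻¹ * w ^ (1 + e) * ∫ x : ℝ, (1 + |x|) ^ (e - 2) := by
  have hi : Integrable (fun x : ℝ => (1 + |x|) ^ (e - 2)) := by
    have := integrable_one_add_norm (E := ℝ) (μ := volume) (r := 2 - e) (by simp; linarith)
    simpa using this
  have heq : ∀ t : ℝ, w ^ 2 * (w + |k * t + c|) ^ (e - 2) =
      w ^ e * (1 + |(k / w) * t + c / w|) ^ (e - 2) := by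
    intro t
    have : w + |k * t + c| = w * (1 + |(k / w) * t + c / w|) := by
      rw [show k / w * t + c / w = (k * t + c) / w by ring, abs_div, abs_of_pos hw]
      field_simp
    rw [this, Real.mul_rpow hw.le (by positivity), ← mul_assoc, ← Real.rpow_natCast,
      ← Real.rpow_add hw]
    congr 2; push_cast; ring
  have hkw : k / w ≠ 0 := div_ne_zero hk hw.ne'
  simp_rw [heq]
  constructor
  · have := ((hi.comp_add_right (c / w)).comp_mul_left' hkw).const_mul (w ^ e)
    exact this
  · rw [integral_const_mul]
    have h1 := Measure.integral_comp_mul_left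
      (fun x : ℝ => (1 + |x + c / w|) ^ (e - 2)) (k / w)
    rw [h1, integral_add_right_eq_self (μ := volume) (fun x : ℝ => (1 + |x|) ^ (e - 2)) (c / w)]
    rw [smul_eq_mul, abs_inv, abs_div, abs_of_pos hw, Real.rpow_add hw, Real.rpow_one]
    field_simp

lemma exists_abs_secDiff_lineInt_le {F : ℝ → ℝ → ℝ} {e C C' : ℝ} (he0 : 0 ≤ e) (he1 : e < 1)
    (hm : Measurable (Function.uncurry F)) (hb : ∀ t z, |F t z| ≤ C' * ((1 + |t|) ^ 2)⁻¹)
    (hz : ∀ t, ∀ z ≤ 0, F t z = 0)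
    (H : ∀ t, SymbolBound e (C * ((1 + |t|) ^ 2)⁻¹) (F t)) {t₀ z₀ : ℝ} (ht : 0 < t₀)
    (hz₀ : 0 < z₀) :
    ∃ K ≥ 0, ∀ s ≠ 0, ∀ w > 0, |secDiff (lineInt F s) (z₀ - s * t₀) w| ≤
      K * (w ^ 2 + |s| * w ^ (1 + e)) := by
  have hC : 0 ≤ C := by
    have := (H 0).const_nonneg
    simpa using this
  set I₁ := ∫ t : ℝ, ((1 + |t|) ^ 2)⁻¹
  set I₂ := ∫ x : ℝ, (1 + |x|) ^ (e - 2)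
  have hI₁ : 0 ≤ I₁ := integral_nonneg fun t => by positivity
  have hI₂ : 0 ≤ I₂ := integral_nonneg fun t => by positivity
  set a := (z₀ / 2) ^ (e - 2)
  set b := ((1 + t₀) * 2 / z₀) ^ 2
  have ha : 0 ≤ a := by positivity
  have hb0 : 0 ≤ b := by positivity
  refine ⟨108 * C * (a * I₁ + b * I₂), by positivity, fun s hs w hw => ?_⟩
  have hs' : 0 < |s| := abs_pos.2 hs
  have hrep : secDiff (lineInt F s) (z₀ - s * t₀) w =
      ∫ t, secDiff (F t) (s * t + (z₀ - s * t₀)) w := by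
    unfold secDiff
    rw [integral_sub, integral_add, integral_const_mul]
    · simp only [lineInt, add_assoc, add_sub_assoc]
    · simpa only [add_assoc] using integrable_line_of_bound hm hb s ((z₀ - s * t₀) + w)
    · simpa only [add_sub_assoc] using integrable_line_of_bound hm hb s ((z₀ - s * t₀) - w)
    · refine Integrable.add ?_ ?_
      · simpa only [add_assoc] using integrable_line_of_bound hm hb s ((z₀ - s * t₀) + w)
      · simpa only [add_sub_assoc] using integrable_line_of_bound hm hb s ((z₀ - s * t₀) - w)
    · exact (integrable_line_of_bound hm hb s (z₀ - s * t₀)).const_mul 2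
  obtain ⟨hi, hiv⟩ := integrable_and_integral_scaled he1 (c := z₀ - s * t₀) hw hs
  have hpt : ∀ t, |secDiff (F t) (s * t + (z₀ - s * t₀)) w| ≤
      108 * C * (a * w ^ 2 * ((1 + |t|) ^ 2)⁻¹ +
        b * s ^ 2 * (w ^ 2 * (w + |s * t + (z₀ - s * t₀)|) ^ (e - 2))) := by
    intro t
    set z := s * t + (z₀ - s * t₀) with hzdef
    refine (abs_secDiff_le_of_symbolBound he0 he1 (H t) (hz t) hw z).trans ?_
    rw [← mul_assoc 108, mul_assoc (108 * C)]
    gcongr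
    have hwz : 0 < w + |z| := by positivity
    rcases le_or_gt (z₀ / 2) |z| with h | h
    · have h1 : (w + |z|) ^ (e - 2) ≤ a :=
        Real.rpow_le_rpow_of_nonpos (by positivity) (by linarith) (by linarith)
      calc ((1 + |t|) ^ 2)⁻¹ * (w ^ 2 * (w + |z|) ^ (e - 2))
          ≤ ((1 + |t|) ^ 2)⁻¹ * (w ^ 2 * a) := by gcongr
        _ = a * w ^ 2 * ((1 + |t|) ^ 2)⁻¹ := by ring
        _ ≤ _ := le_add_of_nonneg_right (by positivity)
    · have h1 : z₀ / 2 ≤ |s| * ((1 + |t|) * (1 + t₀)) := by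
        have e1 : z₀ / 2 ≤ |s * (t - t₀)| := by
          have : s * (t - t₀) = z - z₀ := by rw [hzdef]; ring
          rw [this]
          have := (abs_lt.1 h).2
          rw [abs_of_neg (by linarith)]; linarith
        rw [abs_mul] at e1
        refine e1.trans ?_
        gcongr
        calc |t - t₀| ≤ |t| + t₀ := by
              have := abs_sub t t₀; rwa [abs_of_pos ht] at this
          _ ≤ _ := by nlinarith [abs_nonneg t]
      have h2 : ((1 + |t|) ^ 2)⁻¹ ≤ b * s ^ 2 := by
        rw [inv_le_iff_one_le_mul₀ (by positivity), ← sq_abs s]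
        have : 1 ≤ ((1 + t₀) * 2 / z₀) * |s| * (1 + |t|) := by
          rw [div_mul_eq_mul_div, div_mul_eq_mul_div, le_div_iff₀ hz₀]; nlinarith
        calc (1 : ℝ) ≤ (((1 + t₀) * 2 / z₀) * |s| * (1 + |t|)) ^ 2 := by
              nlinarith
          _ = _ := by ring
      calc ((1 + |t|) ^ 2)⁻¹ * (w ^ 2 * (w + |z|) ^ (e - 2))
          ≤ b * s ^ 2 * (w ^ 2 * (w + |z|) ^ (e - 2)) := by gcongr
        _ ≤ _ := le_add_of_nonneg_left (by positivity)
  rw [hrep]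
  have hi1 := integrable_inv_one_add_abs_sq.const_mul (a * w ^ 2)
  have hi2 := hi.const_mul (b * s ^ 2)
  refine (norm_integral_le_of_norm_le (f := fun t => secDiff (F t) (s * t + (z₀ - s * t₀)) w)
    ((hi1.add hi2).const_mul (108 * C))
    (ae_of_all _ hpt)).trans ?_
  rw [integral_const_mul, integral_add' hi1 hi2, integral_const_mul, integral_const_mul, hiv]
  have : b * s ^ 2 * (|s|⁻¹ * w ^ (1 + e) * I₂) = b * I₂ * (|s| * w ^ (1 + e)) := by
    rw [← sq_abs s]; field_simp
  rw [this, mul_assoc (108 * C)]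
  gcongr
  have := Real.rpow_nonneg hw.le (1 + e)
  change a * w ^ 2 * I₁ + _ ≤ _
  have h1 : 0 ≤ a * I₁ * (|s| * w ^ (1 + e)) := by positivity
  have h2 : 0 ≤ b * I₂ * w ^ 2 := by positivity
  nlinarith

/-- `F` is supported on the open quadrant, smooth there, of order `b` at the edge `z = 0`,
bounded with symbol type derivatives at the edge `t = 0`, and decays at infinity. -/
structure IsQuadrantSymbol (b C : ℝ) (F : ℝ → ℝ → ℝ) : Prop where
  zero_left : ∀ t ≤ 0, ∀ z, F t z = 0
  zero_right : ∀ t, ∀ z ≤ 0, F t z = 0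
  symbol_right : ∀ t > 0, SymbolBound b (C * ((1 + |t|) ^ 2)⁻¹) (F t)
  symbol_decay : ∀ t > 0, SymbolBound (-2) (C * ((1 + |t|) ^ 2)⁻¹) (F t)
  symbol_left : ∀ z > 0, SymbolBound 0 (C * ((1 + |z|) ^ 2)⁻¹) (fun t => F t z)
  continuousOn : ContinuousOn (Function.uncurry F) (Set.Ioi 0 ×ˢ Set.Ioi 0)
  continuousOn_deriv :
    ContinuousOn (fun p : ℝ × ℝ => deriv (F p.1) p.2) (Set.Ioi 0 ×ˢ Set.Ioi 0)

lemma symbolBound_zero (e : ℝ) {C : ℝ} (hC : 0 ≤ C) : SymbolBound e C (fun _ => 0) := by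
  intro x hx
  have : deriv (fun _ : ℝ => (0 : ℝ)) = fun _ => 0 := by ext; simp
  rw [this, this]
  simp only [differentiableAt_const, abs_zero, true_and]
  exact ⟨by positivity, by positivity, by positivity⟩

lemma le_interpolation {a M w σ p q p' q' : ℝ} (ha : 0 ≤ a) (hM : 0 ≤ M) (hw : 0 < w)
    (hσ : 0 < σ) (h : a ≤ M * (w ^ p * σ ^ q)) (h' : a ≤ M * (w ^ p' * σ ^ q')) :
    a ≤ M * (w ^ (p / 4 + 3 * p' / 4) * σ ^ (q / 4 + 3 * q' / 4)) := by
  have h1 : a ^ 4 ≤ (M * (w ^ p * σ ^ q)) * (M * (w ^ p' * σ ^ q')) ^ 3 := by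
    calc a ^ 4 = a * a ^ 3 := by ring
      _ ≤ _ := by gcongr
  have h2 : (M * (w ^ p * σ ^ q)) * (M * (w ^ p' * σ ^ q')) ^ 3 =
      (M * (w ^ (p / 4 + 3 * p' / 4) * σ ^ (q / 4 + 3 * q' / 4))) ^ 4 := by
    have e : ∀ x : ℝ, 0 < x → ∀ r r' : ℝ, (x ^ (r / 4 + 3 * r' / 4)) ^ 4 = x ^ r * (x ^ r') ^ 3 := by
      intro x hx r r'
      rw [← Real.rpow_mul_natCast hx.le, ← Real.rpow_mul_natCast hx.le, ← Real.rpow_add hx]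
      congr 1; push_cast; ring
    have m4 : ∀ x y z : ℝ, (x * (y * z)) ^ 4 = x ^ 4 * (y ^ 4 * z ^ 4) := by intros; ring
    rw [m4, e w hw, e σ hσ]; ring
  rw [h2] at h1
  exact le_of_pow_le_pow_left₀ (by norm_num) (by positivity) h1

/-- The modulus controlling second differences of line integrals. -/
noncomputable def lineModulus (b w : ℝ) : ℝ :=
  if w ≤ 1 then w ^ (1 + b / 4) else w ^ (1 / 2 : ℝ)

lemma lineModulus_nonneg (b : ℝ) {w : ℝ} (hw : 0 ≤ w) : 0 ≤ lineModulus b w := by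
  unfold lineModulus; split_ifs <;> positivity

lemma two_rpow_le : (2 : ℝ) ^ (3 / 4 : ℝ) ≤ 2 := by
  calc (2 : ℝ) ^ (3 / 4 : ℝ) ≤ 2 ^ (1 : ℝ) := by
        apply Real.rpow_le_rpow_of_exponent_le <;> norm_num
    _ = 2 := by norm_num

lemma interpolated_bound {a K s w b : ℝ} (hb0 : 0 < b) (hb1 : b < 1) (hK : 0 ≤ K) (ha : 0 ≤ a)
    (hs : s ≠ 0) (hw : 0 < w) (h1 : a ≤ K * (w ^ 2 + |s| * w ^ (1 + b)))
    (h2 : a ≤ K * ((w ^ 2 + w) / |s| ^ 3)) (h3 : a ≤ K) (h4 : a ≤ K / |s|) :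
    a ≤ 4 * K * ((1 + s ^ 2) ^ (-(3 / 4) : ℝ) * lineModulus b w) := by
  have hs0 : 0 < |s| := abs_pos.2 hs
  set σ := |s| with hσ
  rw [show s ^ 2 = σ ^ 2 by rw [hσ, sq_abs]]
  rcases le_or_gt σ 1 with h | h
  · have e1 : (1 : ℝ) / 2 ≤ (1 + σ ^ 2) ^ (-(3 / 4) : ℝ) := by
      rw [Real.rpow_neg (by positivity), one_div]
      apply inv_anti₀ (by positivity)
      refine le_trans ?_ two_rpow_le
      gcongr
      nlinarith
    have e2 : a ≤ 2 * K * lineModulus b w := by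
      unfold lineModulus
      split_ifs with hw1
      · refine h1.trans ?_
        have i2 : w ^ (1 + b) ≤ w ^ (1 + b / 4) :=
          Real.rpow_le_rpow_of_exponent_ge hw hw1 (by linarith)
        have i3 : w ^ 2 ≤ w ^ (1 + b / 4) := by
          rw [← Real.rpow_two]
          exact Real.rpow_le_rpow_of_exponent_ge hw hw1 (by linarith)
        have : 0 ≤ w ^ (1 + b) := by positivity
        nlinarith [mul_le_of_le_one_left this h]
      · have : 1 ≤ w ^ (1 / 2 : ℝ) := Real.one_le_rpow (by linarith) (by norm_num)
        nlinarith
    have := lineModulus_nonneg b hw.le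
    calc a ≤ 4 * K * (1 / 2 * lineModulus b w) := by linarith
      _ ≤ _ := by gcongr
  · have e1 : σ ^ (-(3 / 2) : ℝ) ≤ 2 * (1 + σ ^ 2) ^ (-(3 / 4) : ℝ) := by
      have : (2 * σ ^ 2) ^ (-(3 / 4) : ℝ) ≤ (1 + σ ^ 2) ^ (-(3 / 4) : ℝ) :=
        Real.rpow_le_rpow_of_nonpos (by positivity) (by nlinarith) (by norm_num)
      rw [Real.mul_rpow (by norm_num) (by positivity), ← Real.rpow_natCast σ 2,
        ← Real.rpow_mul hs0.le, Real.rpow_neg (by norm_num)] at this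
      have h2 : (1 : ℝ) / 2 ≤ (2 ^ (3 / 4 : ℝ))⁻¹ := by
        rw [one_div]; exact inv_anti₀ (by positivity) two_rpow_le
      have h3 : (((2 : ℕ) : ℝ) * -(3 / 4)) = -(3 / 2) := by norm_num
      rw [h3, Real.rpow_natCast] at this
      have : 1 / 2 * σ ^ (-(3 / 2) : ℝ) ≤ (1 + σ ^ 2) ^ (-(3 / 4) : ℝ) :=
        le_trans (by gcongr) this
      linarith
    have e2 : a ≤ 2 * K * (σ ^ (-(3 / 2) : ℝ) * lineModulus b w) := by
      have hi : a ≤ 2 * K * (w ^ (0 : ℝ) * σ ^ (-1 : ℝ)) := h4.trans (by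
        rw [div_eq_mul_inv, Real.rpow_neg_one, Real.rpow_zero, one_mul]; gcongr; linarith)
      unfold lineModulus
      split_ifs with hw1
      · have i1 : a ≤ 2 * K * (w ^ (1 + b) * σ ^ (1 : ℝ)) := h1.trans (by
          rw [mul_comm 2 K, mul_assoc, Real.rpow_one]
          gcongr
          have : w ^ 2 ≤ w ^ (1 + b) := by
            rw [← Real.rpow_two]
            exact Real.rpow_le_rpow_of_exponent_ge hw hw1 (by linarith)
          nlinarith [mul_nonneg (sub_nonneg.2 h.le) (Real.rpow_nonneg hw.le (1 + b))])
        have i2 : a ≤ 2 * K * (w ^ (1 : ℝ) * σ ^ (-3 : ℝ)) := h2.trans (by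
          rw [div_eq_mul_inv, mul_comm 2 K, mul_assoc, ← mul_assoc 2, Real.rpow_one,
            Real.rpow_neg hs0.le]
          norm_cast
          gcongr; nlinarith)
        refine (le_interpolation ha (by positivity) hw hs0 i1 i2).trans ?_
        rw [mul_comm (w ^ _)]
        gcongr 2 * K * (?_ * ?_)
        · apply Real.rpow_le_rpow_of_exponent_le h.le; norm_num
        · apply le_of_eq; congr 1; ring
      · have i1 : a ≤ 2 * K * (w ^ (2 : ℝ) * σ ^ (-3 : ℝ)) := h2.trans (by
          rw [div_eq_mul_inv, mul_comm 2 K, mul_assoc, ← mul_assoc 2, Real.rpow_neg hs0.le]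
          norm_cast
          gcongr; nlinarith)
        refine (le_interpolation ha (by positivity) hw hs0 i1 hi).trans_eq ?_
        rw [mul_comm (w ^ _)]
        norm_num
    have := lineModulus_nonneg b hw.le
    calc a ≤ 2 * K * (2 * (1 + σ ^ 2) ^ (-(3 / 4) : ℝ) * lineModulus b w) := e2.trans (by gcongr)
      _ = _ := by ring

namespace IsQuadrantSymbol

variable {b C : ℝ} {F : ℝ → ℝ → ℝ}

lemma const_nonneg (h : IsQuadrantSymbol b C F) : 0 ≤ C := by
  have := (h.symbol_right 1 one_pos).const_nonneg
  exact nonneg_of_mul_nonneg_left this (by positivity)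

lemma symbol_right' (h : IsQuadrantSymbol b C F) (t : ℝ) :
    SymbolBound b (C * ((1 + |t|) ^ 2)⁻¹) (F t) := by
  rcases le_or_gt t 0 with ht | ht
  · rw [show F t = fun _ => 0 from funext (h.zero_left t ht)]
    exact symbolBound_zero _ (mul_nonneg h.const_nonneg (by positivity))
  · exact h.symbol_right t ht

lemma symbol_left' (h : IsQuadrantSymbol b C F) (z : ℝ) :
    SymbolBound 0 (C * ((1 + |z|) ^ 2)⁻¹) (fun t => F t z) := by
  rcases le_or_gt z 0 with hz | hz
  · rw [show (fun t => F t z) = fun _ => 0 from funext fun t => h.zero_right t z hz]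
    exact symbolBound_zero _ (mul_nonneg h.const_nonneg (by positivity))
  · exact h.symbol_left z hz

lemma abs_le_left (h : IsQuadrantSymbol b C F) (z t : ℝ) : |F t z| ≤ C * ((1 + |z|) ^ 2)⁻¹ := by
  have hC := h.const_nonneg
  rcases le_or_gt t 0 with ht | ht
  · rw [h.zero_left t ht, abs_zero]; positivity
  · simpa using (h.symbol_left' z t ht).2.2.1

lemma abs_le_min (h : IsQuadrantSymbol b C F) (t : ℝ) {z : ℝ} (hz : 0 < z) :
    |F t z| ≤ C * ((1 + |t|) ^ 2)⁻¹ * min (z ^ b) (z ^ (-2 : ℝ)) := by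
  have hC := h.const_nonneg
  rcases le_or_gt t 0 with ht | ht
  · rw [h.zero_left t ht, abs_zero]; positivity
  rw [mul_min_of_nonneg _ _ (by positivity)]
  exact le_min (h.symbol_right t ht z hz).2.2.1 (h.symbol_decay t ht z hz).2.2.1

lemma abs_le_right (h : IsQuadrantSymbol b C F) (hb : 0 ≤ b) (t z : ℝ) :
    |F t z| ≤ C * ((1 + |t|) ^ 2)⁻¹ := by
  have hC := h.const_nonneg
  rcases le_or_gt z 0 with hz | hz
  · rw [h.zero_right t z hz, abs_zero]; positivity
  refine (h.abs_le_min t hz).trans (mul_le_of_le_one_right (by positivity) ?_)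
  rcases le_total z 1 with h1 | h1
  · exact min_le_of_left_le (Real.rpow_le_one hz.le h1 hb)
  · exact min_le_of_right_le (Real.rpow_le_one_of_one_le_of_nonpos h1 (by norm_num))

lemma measurable (h : IsQuadrantSymbol b C F) : Measurable (Function.uncurry F) := by
  have hms : MeasurableSet (Set.Ioi (0 : ℝ) ×ˢ Set.Ioi (0 : ℝ)) :=
    measurableSet_Ioi.prod measurableSet_Ioi
  have := h.continuousOn.measurable_piecewise (g := fun _ => 0) continuousOn_const hms
  convert this using 1
  ext ⟨t, z⟩
  by_cases hp : (t, z) ∈ Set.Ioi (0 : ℝ) ×ˢ Set.Ioi (0 : ℝ)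
  · rw [Set.piecewise_eq_of_mem _ _ _ hp]
  · rw [Set.piecewise_eq_of_notMem _ _ _ hp]
    simp only [Set.mem_prod, Set.mem_Ioi, not_and_or, not_lt] at hp
    rcases hp with hp | hp
    · exact h.zero_left t hp z
    · exact h.zero_right t z hp

lemma exists_abs_secDiff_le (h : IsQuadrantSymbol b C F) (hb0 : 0 < b) (hb1 : b < 1) {t₀ z₀ : ℝ}
    (ht : 0 < t₀) (hz : 0 < z₀) :
    ∃ K ≥ 0, ∀ s ≠ 0, ∀ w > 0, |secDiff (lineInt F s) (z₀ - s * t₀) w| ≤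
      K * ((1 + s ^ 2) ^ (-(3 / 4) : ℝ) * lineModulus b w) := by
  have hm := h.measurable
  have hm' : Measurable (Function.uncurry fun z t => F t z) := hm.comp measurable_swap
  obtain ⟨K₁, hK₁, H₁⟩ := exists_abs_secDiff_lineInt_le hb0.le hb1 hm (h.abs_le_right hb0.le)
    h.zero_right h.symbol_right' ht hz
  obtain ⟨K₂, hK₂, H₂⟩ := exists_abs_secDiff_lineInt_le le_rfl one_pos hm' h.abs_le_left
    (fun z t ht => h.zero_left t ht z) h.symbol_left' hz ht
  set K₃ := C * ∫ t : ℝ, ((1 + |t|) ^ 2)⁻¹ with hK₃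
  have hK₃0 : 0 ≤ K₃ := mul_nonneg h.const_nonneg (integral_nonneg fun t => by positivity)
  have R₁ : ∀ s u, |lineInt F s u| ≤ K₃ := abs_lineInt_le (h.abs_le_right hb0.le)
  have R₂ : ∀ s u, |lineInt (fun z t => F t z) s u| ≤ K₃ := abs_lineInt_le h.abs_le_left
  have hsec : ∀ g : ℝ → ℝ, (∀ u, |g u| ≤ K₃) → ∀ a w, |secDiff g a w| ≤ 4 * K₃ := by
    intro g hg a w
    have e1 := hg (a + w)
    have e2 := hg (a - w)
    have e3 := hg a
    unfold secDiff
    rw [abs_le] at *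
    constructor <;> linarith
  refine ⟨4 * (K₁ + K₂ + 4 * K₃), by positivity, fun s hs w hw => ?_⟩
  have hs0 : 0 < |s| := abs_pos.2 hs
  have hswap : secDiff (lineInt F s) (z₀ - s * t₀) w =
      |s⁻¹| * secDiff (lineInt (fun z t => F t z) s⁻¹) (t₀ - s⁻¹ * z₀) (s⁻¹ * w) := by
    unfold secDiff
    rw [lineInt_swap F hs, lineInt_swap F hs, lineInt_swap F hs]
    have e1 : -(s⁻¹ * (z₀ - s * t₀ + w)) = t₀ - s⁻¹ * z₀ - s⁻¹ * w := by field_simp; ring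
    have e2 : -(s⁻¹ * (z₀ - s * t₀ - w)) = t₀ - s⁻¹ * z₀ + s⁻¹ * w := by field_simp; ring
    have e3 : -(s⁻¹ * (z₀ - s * t₀)) = t₀ - s⁻¹ * z₀ := by field_simp; ring
    rw [e1, e2, e3]; ring
  have hswap' : secDiff (lineInt F s) (z₀ - s * t₀) w =
      |s⁻¹| * secDiff (lineInt (fun z t => F t z) s⁻¹) (t₀ - s⁻¹ * z₀) (|s⁻¹| * w) := by
    rw [hswap]
    rcases abs_choice s⁻¹ with h1 | h1
    · simp_rw [h1]
    · conv_rhs => rw [h1, neg_mul s⁻¹ w, secDiff_neg]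
      rw [h1]
  refine interpolated_bound hb0 hb1 (by positivity) (abs_nonneg _) hs hw ?_ ?_ ?_ ?_
  · refine (H₁ s hs w hw).trans ?_
    gcongr; linarith
  · rw [hswap', abs_mul, abs_abs]
    have := H₂ s⁻¹ (inv_ne_zero hs) (|s⁻¹| * w) (by positivity)
    rw [add_zero, Real.rpow_one] at this
    calc |s⁻¹| * _ ≤ |s⁻¹| * (K₂ * ((|s⁻¹| * w) ^ 2 + |s⁻¹| * (|s⁻¹| * w))) := by gcongr
      _ = K₂ * ((w ^ 2 + w) / |s| ^ 3) := by rw [abs_inv]; field_simp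
      _ ≤ _ := by gcongr; linarith
  · refine (hsec _ (R₁ s) _ _).trans ?_
    linarith
  · rw [hswap', abs_mul, abs_abs, abs_inv, div_eq_inv_mul]
    gcongr
    refine (hsec _ (R₂ _) _ _).trans ?_
    linarith

end IsQuadrantSymbol

/-- Integrable majorant: order `e` at `0`, order `-2` at infinity. -/
noncomputable def edgeWeight (e z : ℝ) : ℝ :=
  (Set.Ioc 0 1).indicator (fun z => z ^ e) z + (Set.Ioi 1).indicator (fun z => z ^ (-2 : ℝ)) z

lemma edgeWeight_nonneg (e z : ℝ) : 0 ≤ edgeWeight e z := by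
  refine add_nonneg (Set.indicator_nonneg (fun x hx => ?_) _)
    (Set.indicator_nonneg (fun x hx => ?_) _)
  · exact Real.rpow_nonneg hx.1.le _
  · exact Real.rpow_nonneg (zero_le_one.trans (le_of_lt hx)) _

lemma integrable_edgeWeight {e : ℝ} (he : -1 < e) : Integrable (edgeWeight e) := by
  refine Integrable.add ?_ ?_
  · rw [integrable_indicator_iff measurableSet_Ioc,
      ← intervalIntegrable_iff_integrableOn_Ioc_of_le zero_le_one]
    exact intervalIntegral.intervalIntegrable_rpow' he
  · rw [integrable_indicator_iff measurableSet_Ioi]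
    exact integrableOn_Ioi_rpow_of_lt (by norm_num) one_pos

lemma le_edgeWeight {e e' a M z : ℝ} (hz : 0 < z) (hM : 0 ≤ M) (he' : e' ≤ -2)
    (h : a ≤ M * z ^ e) (h' : a ≤ M * z ^ e') : a ≤ M * edgeWeight e z := by
  unfold edgeWeight
  rcases le_or_gt z 1 with h1 | h1
  · rw [Set.indicator_of_mem (show z ∈ Set.Ioc 0 1 from ⟨hz, h1⟩),
      Set.indicator_of_notMem (by simpa using h1), add_zero]
    exact h
  · rw [Set.indicator_of_notMem (by simp [h1]), Set.indicator_of_mem (by simpa using h1),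
      zero_add]
    refine h'.trans ?_
    gcongr
    exact h1.le

lemma measurePreserving_shear (s : ℝ) :
    MeasurePreserving (fun p : ℝ × ℝ => (p.1, s * p.1 + p.2)) volume volume := by
  refine (MeasurePreserving.id volume).skew_product (g := fun t z => s * t + z) (by fun_prop)
    (ae_of_all _ fun t => ?_)
  exact map_add_left_eq_self volume (s * t)

lemma MeasureTheory.Integrable.comp_shear {H : ℝ → ℝ → ℝ}
    (hH : Integrable (Function.uncurry H)) (s : ℝ) :
    Integrable (fun p : ℝ × ℝ => H p.1 (s * p.1 + p.2)) :=
  ((measurePreserving_shear s).integrable_comp hH.aestronglyMeasurable).2 hH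

lemma setIntegral_Iic_comp_add_left (g : ℝ → ℝ) (c u : ℝ) :
    ∫ x in Set.Iic u, g (c + x) = ∫ x in Set.Iic (c + u), g x := by
  rw [← integral_indicator measurableSet_Iic, ← integral_indicator measurableSet_Iic,
    ← integral_add_left_eq_self (μ := volume) ((Set.Iic (c + u)).indicator g) c]
  congr 1; ext x
  simp only [Set.indicator, Set.mem_Iic, add_le_add_iff_left]

lemma integrable_lineInt {H : ℝ → ℝ → ℝ} (hH : Integrable (Function.uncurry H)) (s : ℝ) :
    Integrable (lineInt H s) :=
  (hH.comp_shear s).integral_prod_right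

lemma setIntegral_Iic_lineInt {H : ℝ → ℝ → ℝ} (hH : Integrable (Function.uncurry H)) (s u : ℝ) :
    ∫ v in Set.Iic u, lineInt H s v = ∫ t, ∫ z in Set.Iic (s * t + u), H t z := by
  have : Integrable (fun p : ℝ × ℝ => H p.1 (s * p.1 + p.2))
      (volume.prod (volume.restrict (Set.Iic u))) := by
    have := (hH.comp_shear s).integrableOn (s := Set.univ ×ˢ Set.Iic u)
    rwa [IntegrableOn, Measure.volume_eq_prod, ← Measure.prod_restrict,
      Measure.restrict_univ] at this
  unfold lineInt
  rw [← integral_integral_swap (f := fun t v => H t (s * t + v)) this]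
  congr 1; ext t
  exact setIntegral_Iic_comp_add_left (H t) (s * t) u

namespace IsQuadrantSymbol

variable {b C : ℝ} {F : ℝ → ℝ → ℝ}

lemma integrable (h : IsQuadrantSymbol b C F) (hb : 0 < b) : Integrable (Function.uncurry F) := by
  refine ((integrable_inv_one_add_abs_sq.const_mul C).mul_prod
    (integrable_edgeWeight (e := b) (by linarith))).mono' h.measurable.aestronglyMeasurable
    (ae_of_all _ fun ⟨t, z⟩ => ?_)
  have hC := h.const_nonneg
  have hE := edgeWeight_nonneg b z
  simp only [Function.uncurry, Real.norm_eq_abs]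
  rcases le_or_gt z 0 with hz | hz
  · rw [h.zero_right t z hz, abs_zero]; positivity
  have := h.abs_le_min t hz
  rw [mul_min_of_nonneg _ _ (by positivity)] at this
  exact le_edgeWeight hz (by positivity) le_rfl (this.trans (min_le_left _ _))
    (this.trans (min_le_right _ _))

end IsQuadrantSymbol

/-- The derivative in the second variable, set to zero off the upper half plane. -/
noncomputable def derivSnd (F : ℝ → ℝ → ℝ) (t z : ℝ) : ℝ := if 0 < z then deriv (F t) z else 0

namespace IsQuadrantSymbol

variable {b C : ℝ} {F : ℝ → ℝ → ℝ}

lemma derivSnd_eq_zero (h : IsQuadrantSymbol b C F) {t z : ℝ} (htz : t ≤ 0 ∨ z ≤ 0) :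
    derivSnd F t z = 0 := by
  unfold derivSnd
  rcases htz with ht | hz
  · rw [show F t = fun _ => 0 from funext (h.zero_left t ht)]; simp
  · rw [if_neg hz.not_gt]

lemma measurable_derivSnd (h : IsQuadrantSymbol b C F) :
    Measurable (Function.uncurry (derivSnd F)) := by
  have hms : MeasurableSet (Set.Ioi (0 : ℝ) ×ˢ Set.Ioi (0 : ℝ)) :=
    measurableSet_Ioi.prod measurableSet_Ioi
  have := h.continuousOn_deriv.measurable_piecewise (g := fun _ => 0) continuousOn_const hms
  convert this using 1
  ext ⟨t, z⟩
  by_cases hp : (t, z) ∈ Set.Ioi (0 : ℝ) ×ˢ Set.Ioi (0 : ℝ)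
  · rw [Set.piecewise_eq_of_mem _ _ _ hp]
    exact if_pos hp.2
  · rw [Set.piecewise_eq_of_notMem _ _ _ hp]
    simp only [Set.mem_prod, Set.mem_Ioi, not_and_or, not_lt] at hp
    exact h.derivSnd_eq_zero hp

lemma abs_derivSnd_le (h : IsQuadrantSymbol b C F) (t z : ℝ) :
    |derivSnd F t z| ≤ C * ((1 + |t|) ^ 2)⁻¹ * edgeWeight (b - 1) z := by
  have hC := h.const_nonneg
  have hE := edgeWeight_nonneg (b - 1) z
  by_cases h0 : t ≤ 0 ∨ z ≤ 0
  · rw [h.derivSnd_eq_zero h0, abs_zero]; positivity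
  push Not at h0
  rw [derivSnd, if_pos h0.2]
  exact le_edgeWeight (e' := -2 - 1) h0.2 (by positivity) (by norm_num)
    (h.symbol_right t h0.1 z h0.2).2.2.2.1 (h.symbol_decay t h0.1 z h0.2).2.2.2.1

lemma integrable_derivSnd (h : IsQuadrantSymbol b C F) (hb : 0 < b) :
    Integrable (Function.uncurry (derivSnd F)) :=
  ((integrable_inv_one_add_abs_sq.const_mul C).mul_prod
    (integrable_edgeWeight (e := b - 1) (by linarith))).mono'
    h.measurable_derivSnd.aestronglyMeasurable (ae_of_all _ fun ⟨t, z⟩ => h.abs_derivSnd_le t z)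

lemma continuous_snd (h : IsQuadrantSymbol b C F) (hb : 0 < b) (t : ℝ) : Continuous (F t) := by
  rw [continuous_iff_continuousAt]
  intro z
  rcases lt_trichotomy z 0 with hz | rfl | hz
  · refine continuousAt_const.congr (f := fun _ => 0) ?_
    filter_upwards [Iio_mem_nhds hz] with y hy using (h.zero_right t y (le_of_lt hy)).symm
  · rw [ContinuousAt, h.zero_right t 0 le_rfl]
    set M := C * ((1 + |t|) ^ 2)⁻¹
    refine squeeze_zero_norm (a := fun z => M * |z| ^ b) (fun z => ?_) ?_
    · have hM : 0 ≤ M := mul_nonneg h.const_nonneg (by positivity)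
      rcases le_or_gt z 0 with hz | hz
      · rw [h.zero_right t z hz, norm_zero]; positivity
      · rw [abs_of_pos hz]; exact (h.symbol_right' t z hz).2.2.1
    · have : Continuous fun z : ℝ => M * |z| ^ b :=
        continuous_const.mul (continuous_abs.rpow_const fun x => Or.inr hb.le)
      have h0 := this.tendsto 0
      simpa [Real.zero_rpow hb.ne'] using h0
  · exact (h.symbol_right' t z hz).1.continuousAt

lemma integrable_derivSnd_right (h : IsQuadrantSymbol b C F) (hb : 0 < b) (t : ℝ) :
    Integrable (derivSnd F t) :=
  ((integrable_edgeWeight (e := b - 1) (by linarith)).const_mul _).mono'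
    (h.measurable_derivSnd.comp (measurable_prodMk_left (x := t))).aestronglyMeasurable
    (ae_of_all _ fun z => h.abs_derivSnd_le t z)

lemma eq_setIntegral_derivSnd (h : IsQuadrantSymbol b C F) (hb : 0 < b) (t z : ℝ) :
    ∫ y in Set.Iic z, derivSnd F t y = F t z := by
  have h0 : ∀ x ≤ 0, ∫ y in Set.Iic x, derivSnd F t y = 0 := fun x hx =>
    setIntegral_eq_zero_of_forall_eq_zero fun y hy =>
      h.derivSnd_eq_zero (Or.inr ((Set.mem_Iic.1 hy).trans hx))
  rcases le_or_gt z 0 with hz | hz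
  · rw [h0 z hz, h.zero_right t z hz]
  have hi := h.integrable_derivSnd_right hb t
  have h1 := intervalIntegral.integral_Iic_sub_Iic (hi.integrableOn (s := Set.Iic 0))
    (hi.integrableOn (s := Set.Iic z))
  rw [h0 0 le_rfl, sub_zero] at h1
  rw [h1, intervalIntegral.integral_eq_sub_of_hasDerivAt_of_le hz.le
    (h.continuous_snd hb t).continuousOn _ hi.intervalIntegrable, h.zero_right t 0 le_rfl, sub_zero]
  intro x hx
  rw [derivSnd, if_pos hx.1]
  exact (h.symbol_right' t x hx.1).1.hasDerivAt

lemma continuous_lineInt_derivSnd (h : IsQuadrantSymbol b C F) (hb : 0 < b) {s : ℝ} (hs : s ≠ 0) :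
    Continuous (lineInt (derivSnd F) s) := by
  have hC := h.const_nonneg
  have heq : lineInt (derivSnd F) s =
      fun u => |s⁻¹| * ∫ z, derivSnd F (s⁻¹ * z + -(s⁻¹ * u)) z := by
    ext u; rw [lineInt_swap _ hs]; rfl
  rw [heq]
  refine continuous_const.mul (continuous_iff_continuousAt.2 fun u₀ => ?_)
  refine continuousAt_of_dominated (bound := fun z => C * edgeWeight (b - 1) z)
    (Eventually.of_forall fun u => ?_) (Eventually.of_forall fun u => ae_of_all _ fun z => ?_)
    ((integrable_edgeWeight (by linarith)).const_mul C) ?_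
  · exact (h.measurable_derivSnd.comp
      (f := fun z : ℝ => (s⁻¹ * z + -(s⁻¹ * u), z)) (by fun_prop)).aestronglyMeasurable
  · refine (h.abs_derivSnd_le _ _).trans ?_
    have := edgeWeight_nonneg (b - 1) z
    gcongr
    refine mul_le_of_le_one_right hC (inv_le_one_of_one_le₀ (one_le_pow₀ ?_))
    linarith [abs_nonneg (s⁻¹ * z + -(s⁻¹ * u))]
  · have : ∀ᵐ z : ℝ, z ≠ u₀ := by simp [ae_iff]
    filter_upwards [this] with z hz
    have hc : Continuous fun u => s⁻¹ * z + -(s⁻¹ * u) := by fun_prop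
    rcases le_or_gt z 0 with hz0 | hz0
    · simp_rw [h.derivSnd_eq_zero (Or.inr hz0)]; exact continuousAt_const
    have hne : s⁻¹ * z + -(s⁻¹ * u₀) ≠ 0 := by
      rw [← sub_eq_add_neg, ← mul_sub]
      exact mul_ne_zero (inv_ne_zero hs) (sub_ne_zero.2 hz)
    rcases hne.lt_or_gt with hlt | hgt
    · refine continuousAt_const.congr (f := fun _ => 0) ?_
      filter_upwards [hc.continuousAt.eventually (Iio_mem_nhds hlt)] with u hu
      exact (h.derivSnd_eq_zero (Or.inl (le_of_lt hu))).symm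
    · simp only [derivSnd, if_pos hz0]
      have h1 : ContinuousAt (fun p : ℝ × ℝ => deriv (F p.1) p.2) (s⁻¹ * z + -(s⁻¹ * u₀), z) :=
        h.continuousOn_deriv.continuousAt
          ((isOpen_Ioi.prod isOpen_Ioi).mem_nhds ⟨hgt, hz0⟩)
      exact ContinuousAt.comp (f := fun u => (s⁻¹ * z + -(s⁻¹ * u), z)) h1 (by fun_prop)

lemma hasDerivAt_lineInt (h : IsQuadrantSymbol b C F) (hb : 0 < b) {s : ℝ} (hs : s ≠ 0) (u : ℝ) :
    HasDerivAt (lineInt F s) (lineInt (derivSnd F) s u) u := by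
  have hi := integrable_lineInt (h.integrable_derivSnd hb) s
  have hrep : ∀ v, lineInt F s v = ∫ x in Set.Iic v, lineInt (derivSnd F) s x := by
    intro v
    rw [setIntegral_Iic_lineInt (h.integrable_derivSnd hb)]
    simp_rw [h.eq_setIntegral_derivSnd hb]
    rfl
  have hrep' : lineInt F s = fun v => lineInt F s 0 + ∫ x in (0 : ℝ)..v, lineInt (derivSnd F) s x := by
    ext v
    rw [← intervalIntegral.integral_Iic_sub_Iic hi.integrableOn hi.integrableOn, ← hrep, ← hrep]
    ring
  rw [hrep']
  have hc := h.continuous_lineInt_derivSnd hb hs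
  exact (intervalIntegral.integral_hasDerivAt_right (hc.intervalIntegrable _ _)
    hc.stronglyMeasurable.stronglyMeasurableAtFilter hc.continuousAt).const_add _

end IsQuadrantSymbol

lemma integrableOn_lineModulus_div_sq {b : ℝ} (hb : 0 < b) :
    IntegrableOn (fun w => lineModulus b w / w ^ 2) (Set.Ioi 0) := by
  rw [← Set.Ioc_union_Ioi_eq_Ioi zero_le_one]
  refine IntegrableOn.union ?_ ?_
  · have h1 : IntegrableOn (fun w : ℝ => w ^ (b / 4 - 1)) (Set.Ioc 0 1) := by
      rw [← intervalIntegrable_iff_integrableOn_Ioc_of_le zero_le_one]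
      exact intervalIntegral.intervalIntegrable_rpow' (by linarith)
    refine h1.congr_fun (fun w hw => ?_) measurableSet_Ioc
    dsimp only
    rw [lineModulus, if_pos hw.2, ← Real.rpow_two, ← Real.rpow_sub hw.1]
    congr 1; ring
  · have h1 : IntegrableOn (fun w : ℝ => w ^ (-(3 / 2) : ℝ)) (Set.Ioi 1) :=
      integrableOn_Ioi_rpow_of_lt (by norm_num) one_pos
    refine h1.congr_fun (fun w hw => ?_) measurableSet_Ioi
    dsimp only
    rw [lineModulus, if_neg (not_le.2 hw), ← Real.rpow_two,
      ← Real.rpow_sub (zero_lt_one.trans hw)]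
    norm_num

lemma tendsto_lineModulus_div_zero {b : ℝ} (hb : 0 < b) :
    Tendsto (fun w => lineModulus b w / w) (𝓝[>] 0) (𝓝 0) := by
  have h1 : Tendsto (fun w : ℝ => w ^ (b / 4)) (𝓝[>] 0) (𝓝 0) := by
    have := (Real.continuousAt_rpow_const 0 (b / 4) (Or.inr (by linarith))).tendsto
    rw [Real.zero_rpow (by linarith)] at this
    exact this.mono_left nhdsWithin_le_nhds
  refine h1.congr' ?_
  filter_upwards [Ioc_mem_nhdsGT (zero_lt_one' ℝ)] with w hw
  rw [lineModulus, if_pos hw.2]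
  nth_rw 3 [← Real.rpow_one w]
  rw [← Real.rpow_sub hw.1]
  congr 1; ring

lemma tendsto_lineModulus_div_atTop (b : ℝ) :
    Tendsto (fun w => lineModulus b w / w) atTop (𝓝 0) := by
  refine (tendsto_rpow_neg_atTop (y := 1 / 2) (by norm_num)).congr' ?_
  filter_upwards [eventually_gt_atTop 1] with w hw
  rw [lineModulus, if_neg (not_le.2 hw)]
  nth_rw 3 [← Real.rpow_one w]
  rw [← Real.rpow_sub (zero_lt_one.trans hw)]
  norm_num

lemma continuous_secDiff {r : ℝ → ℝ} (hr : Continuous r) (v : ℝ) : Continuous (secDiff r v) := by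
  unfold secDiff; fun_prop

lemma integrableOn_secDiff_div_sq {r : ℝ → ℝ} (hr : Continuous r) {v K b : ℝ} (hb : 0 < b)
    (hA : ∀ w > 0, |secDiff r v w| ≤ K * lineModulus b w) :
    IntegrableOn (fun w => secDiff r v w / w ^ 2) (Set.Ioi 0) := by
  refine ((integrableOn_lineModulus_div_sq hb).const_mul K).mono'
    (((continuous_secDiff hr v).measurable.div (by fun_prop)).aestronglyMeasurable) ?_
  filter_upwards [ae_restrict_mem measurableSet_Ioi] with w hw
  have hw : 0 < w := hw
  rw [Real.norm_eq_abs, abs_div, abs_of_nonneg (sq_nonneg w), ← mul_div_assoc]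
  gcongr
  exact hA w hw

lemma setIntegral_truncated_eq {r g : ℝ → ℝ} (hr : ∀ u, HasDerivAt r (g u) u)
    (hgi : Integrable g) {v K b : ℝ} (hb : 0 < b)
    (hA : ∀ w > 0, |secDiff r v w| ≤ K * lineModulus b w) {ε : ℝ} (hε : 0 < ε) :
    ∫ u in {u : ℝ | ε < |u - v|}, g u / (v - u) =
      secDiff r v ε / ε - ∫ w in Set.Ioi ε, secDiff r v w / w ^ 2 := by
  have hrc : Continuous r := continuous_iff_continuousAt.2 fun u => (hr u).continuousAt
  have hinv : ∀ q : ℝ → ℝ, Integrable q → IntegrableOn (fun w => q w / w) (Set.Ioi ε) := by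
    intro q hq
    refine (hq.norm.div_const ε).integrableOn.mono'
      (hq.aemeasurable.restrict.div (by fun_prop)).aestronglyMeasurable ?_
    filter_upwards [ae_restrict_mem measurableSet_Ioi] with w hw
    have hw : ε < w := hw
    rw [norm_div, Real.norm_of_nonneg (by linarith : (0:ℝ) ≤ w)]
    gcongr
  have hp : IntegrableOn (fun w => g (v + w) / w) (Set.Ioi ε) :=
    hinv _ (hgi.comp_add_left v)
  have hm : IntegrableOn (fun w => g (v - w) / w) (Set.Ioi ε) :=
    hinv _ (hgi.comp_sub_left v)
  have hset : {u : ℝ | ε < |u - v|} = Set.Iio (v - ε) ∪ Set.Ioi (v + ε) := by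
    ext u
    simp only [Set.mem_ofPred_eq, Set.mem_union, Set.mem_Iio, Set.mem_Ioi, lt_abs]
    constructor <;> rintro (h | h)
    · right; linarith
    · left; linarith
    · right; linarith
    · left; linarith
  have etrans : ∀ q : ℝ → ℝ, ∫ u in Set.Ioi (v + ε), q u = ∫ w in Set.Ioi ε, q (v + w) := by
    intro q
    rw [← integral_indicator measurableSet_Ioi, ← integral_indicator measurableSet_Ioi,
      ← integral_add_left_eq_self (μ := volume) _ v]
    congr 1; ext x
    simp only [Set.indicator, Set.mem_Ioi, add_lt_add_iff_left]
  have etrans' : ∀ q : ℝ → ℝ, ∫ u in Set.Iio (v - ε), q u = ∫ w in Set.Ioi ε, q (v - w) := by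
    intro q
    rw [← integral_indicator measurableSet_Iio, ← integral_indicator measurableSet_Ioi,
      ← integral_sub_left_eq_self _ volume v]
    congr 1; ext x
    simp only [Set.indicator, Set.mem_Ioi, Set.mem_Iio, sub_lt_sub_iff_left]
  have hi : ∀ s : Set ℝ, MeasurableSet s → (∀ u ∈ s, ε < |u - v|) →
      IntegrableOn (fun u => g u / (v - u)) s := by
    intro s hs hsv
    refine (hgi.norm.div_const ε).integrableOn.mono'
      (hgi.aemeasurable.restrict.div (by fun_prop)).aestronglyMeasurable ?_
    filter_upwards [ae_restrict_mem hs] with w hw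
    have hw := hsv w hw
    rw [norm_div, Real.norm_eq_abs (v - w), abs_sub_comm]
    gcongr
  have hd : ∀ w ∈ Set.Ici ε, HasDerivAt (fun w => secDiff r v w / w)
      ((g (v + w) / w - g (v - w) / w) - secDiff r v w / w ^ 2) w := by
    intro w hw
    have hw : 0 < w := hε.trans_le hw
    have e1 := (hr (v + w)).comp_const_add v w
    have e2 := (hr (v - w)).comp_const_sub v w
    have e3 : HasDerivAt (secDiff r v) (g (v + w) - g (v - w)) w :=
      ((e1.add e2).sub_const (2 * r v)).congr_deriv (by ring)
    refine (e3.div (hasDerivAt_id w) hw.ne').congr_deriv ?_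
    simp only [id]; field_simp
  have hAi : IntegrableOn (fun w => secDiff r v w / w ^ 2) (Set.Ioi ε) :=
    (integrableOn_secDiff_div_sq hrc hb hA).mono_set (Set.Ioi_subset_Ioi hε.le)
  have hlim : Tendsto (fun w => secDiff r v w / w) atTop (𝓝 0) := by
    have := (tendsto_lineModulus_div_atTop b).const_mul K
    rw [mul_zero] at this
    refine squeeze_zero_norm' ?_ this
    filter_upwards [eventually_gt_atTop 0] with w hw
    rw [norm_div, Real.norm_of_nonneg hw.le, ← mul_div_assoc]
    gcongr
    exact hA w hw
  have key := integral_Ioi_of_hasDerivAt_of_tendsto' hd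
    ((hp.sub hm).sub hAi) hlim
  have hpm : IntegrableOn (fun w => g (v + w) / w - g (v - w) / w) (Set.Ioi ε) := hp.sub hm
  rw [integral_sub hpm hAi, integral_sub hp hm] at key
  have hdisj : Disjoint (Set.Iio (v - ε)) (Set.Ioi (v + ε)) := by
    rw [Set.disjoint_left]; intro x h1 h2
    simp only [Set.mem_Iio, Set.mem_Ioi] at h1 h2; linarith
  rw [hset, setIntegral_union hdisj measurableSet_Ioi
    (hi _ measurableSet_Iio fun u hu => ?_) (hi _ measurableSet_Ioi fun u hu => ?_),
    etrans, etrans']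
  · have e1 : ∫ w in Set.Ioi ε, g (v - w) / (v - (v - w)) = ∫ w in Set.Ioi ε, g (v - w) / w := by
      simp
    have e2 : ∫ w in Set.Ioi ε, g (v + w) / (v - (v + w)) =
        - ∫ w in Set.Ioi ε, g (v + w) / w := by
      rw [← integral_neg]; congr 1; ext w; rw [sub_add_cancel_left, div_neg]
    rw [e1, e2]
    linarith
  · have hu : u < v - ε := hu
    rw [lt_abs]; right; linarith
  · have hu : v + ε < u := hu
    rw [lt_abs]; left; linarith

lemma pv_deriv_eq {r g : ℝ → ℝ} (hr : ∀ u, HasDerivAt r (g u) u)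
    (hgi : Integrable g) {v K b : ℝ} (hb : 0 < b)
    (hA : ∀ w > 0, |secDiff r v w| ≤ K * lineModulus b w) :
    pv (fun u => deriv r u / (v - u)) v = - ∫ w in Set.Ioi 0, secDiff r v w / w ^ 2 := by
  have hrc : Continuous r := continuous_iff_continuousAt.2 fun u => (hr u).continuousAt
  have hAi := integrableOn_secDiff_div_sq hrc hb hA
  refine Tendsto.limUnder_eq ?_
  have h1 : Tendsto (fun ε => secDiff r v ε / ε) (𝓝[>] 0) (𝓝 0) := by
    have := (tendsto_lineModulus_div_zero hb).const_mul K
    rw [mul_zero] at this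
    refine squeeze_zero_norm' ?_ this
    filter_upwards [self_mem_nhdsWithin] with w hw
    have hw : 0 < w := hw
    rw [norm_div, Real.norm_of_nonneg hw.le, ← mul_div_assoc]
    gcongr
    exact hA w hw
  have h2 : Tendsto (fun ε => ∫ w in Set.Ioi ε, secDiff r v w / w ^ 2) (𝓝[>] 0)
      (𝓝 (∫ w in Set.Ioi 0, secDiff r v w / w ^ 2)) := by
    have hc : AECover (volume.restrict (Set.Ioi (0 : ℝ))) (𝓝[>] (0 : ℝ)) fun ε => Set.Ioi ε :=
      aecover_Ioi_of_Ioi (tendsto_id.mono_left nhdsWithin_le_nhds)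
    refine (hc.integral_tendsto_of_countably_generated hAi).congr' ?_
    filter_upwards [self_mem_nhdsWithin] with ε hε
    rw [Measure.restrict_restrict measurableSet_Ioi,
      Set.inter_eq_self_of_subset_left (Set.Ioi_subset_Ioi (le_of_lt hε))]
  have h3 := h1.sub h2
  rw [zero_sub] at h3
  refine h3.congr' ?_
  filter_upwards [self_mem_nhdsWithin] with ε hε
  rw [← setIntegral_truncated_eq hr hgi hb hA hε]
  simp_rw [fun u => (hr u).deriv]

lemma tendsto_linear_div_quadratic {l : Filter ℝ} (hl : Tendsto (fun s : ℝ => s⁻¹) l (𝓝 0))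
    (hl0 : ∀ᶠ s in l, s ≠ 0) {A B p q r : ℝ} (hp : p ≠ 0) :
    Tendsto (fun s => (A * s + B) / (p * s ^ 2 + q * s + r)) l (𝓝 0) := by
  have h1 : Tendsto (fun s : ℝ => (A * s⁻¹ + B * s⁻¹ ^ 2) / (p + q * s⁻¹ + r * s⁻¹ ^ 2)) l
      (𝓝 ((A * 0 + B * 0 ^ 2) / (p + q * 0 + r * 0 ^ 2))) :=
    ((hl.const_mul A).add ((hl.pow 2).const_mul B)).div
      (((hl.const_mul q).const_add p).add ((hl.pow 2).const_mul r)) (by simpa using hp)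
  have e : (A * 0 + B * 0 ^ 2) / (p + q * 0 + r * 0 ^ 2) = 0 := by simp
  rw [e] at h1
  refine h1.congr' ?_
  filter_upwards [hl0] with s hs
  have e1 : A * s⁻¹ + B * s⁻¹ ^ 2 = (A * s + B) * s⁻¹ ^ 2 := by field_simp
  have e2 : p + q * s⁻¹ + r * s⁻¹ ^ 2 = (p * s ^ 2 + q * s + r) * s⁻¹ ^ 2 := by field_simp
  rw [e1, e2, mul_div_mul_right _ _ (by positivity)]

/-- A regularisation of `-1 / w ^ 2` with vanishing integral. -/
noncomputable def hadamardKernel (δ w : ℝ) : ℝ := (δ ^ 2 - w ^ 2) / (w ^ 2 + δ ^ 2) ^ 2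

lemma hadamardKernel_neg (δ w : ℝ) : hadamardKernel δ (-w) = hadamardKernel δ w := by
  simp [hadamardKernel]

lemma abs_hadamardKernel_le {δ : ℝ} (hδ : δ ≠ 0) (w : ℝ) :
    |hadamardKernel δ w| ≤ (w ^ 2 + δ ^ 2)⁻¹ := by
  have : 0 < w ^ 2 + δ ^ 2 := by positivity
  rw [hadamardKernel, abs_div, abs_of_nonneg (by positivity : 0 ≤ (w ^ 2 + δ ^ 2) ^ 2),
    div_le_iff₀ (by positivity), sq (w ^ 2 + δ ^ 2), ← mul_assoc, inv_mul_cancel₀ this.ne', one_mul,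
    abs_le]
  constructor <;> nlinarith [sq_nonneg w, sq_nonneg δ]

lemma abs_hadamardKernel_le' {δ : ℝ} (hδ : δ ≠ 0) (w : ℝ) :
    |hadamardKernel δ w| ≤ (δ ^ 2)⁻¹ :=
  (abs_hadamardKernel_le hδ w).trans (inv_anti₀ (by positivity) (by nlinarith [sq_nonneg w]))

lemma continuous_hadamardKernel {δ : ℝ} (hδ : δ ≠ 0) : Continuous (hadamardKernel δ) := by
  unfold hadamardKernel
  exact Continuous.div (by fun_prop) (by fun_prop) fun w => by positivity

lemma integrable_hadamardKernel {δ : ℝ} (hδ : δ ≠ 0) : Integrable (hadamardKernel δ) := by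
  have h1 : Integrable fun w : ℝ => (δ ^ 2)⁻¹ * (1 + (w / δ) ^ 2)⁻¹ :=
    (integrable_inv_one_add_sq.comp_div hδ).const_mul _
  refine h1.mono' (continuous_hadamardKernel hδ).aestronglyMeasurable (ae_of_all _ fun w => ?_)
  rw [Real.norm_eq_abs]
  refine (abs_hadamardKernel_le hδ w).trans_eq ?_
  rw [← mul_inv]; congr 1; field_simp; ring

lemma hasDerivAt_div_sq_add_sq {δ : ℝ} (hδ : δ ≠ 0) (w : ℝ) :
    HasDerivAt (fun w : ℝ => w / (w ^ 2 + δ ^ 2)) (hadamardKernel δ w) w := by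
  have h := (hasDerivAt_id' w).div ((hasDerivAt_pow 2 w).add_const (δ ^ 2))
    (ne_of_gt (by positivity : 0 < w ^ 2 + δ ^ 2))
  refine h.congr_deriv ?_
  rw [hadamardKernel]
  congr 1
  norm_num; ring

lemma setIntegral_Ioi_hadamardKernel {δ : ℝ} (hδ : δ ≠ 0) :
    ∫ w in Set.Ioi 0, hadamardKernel δ w = 0 := by
  have h := integral_Ioi_of_hasDerivAt_of_tendsto' (a := 0) (m := 0)
    (fun w _ => hasDerivAt_div_sq_add_sq hδ w) (integrable_hadamardKernel hδ).integrableOn ?_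
  · rw [h]; simp
  · have := tendsto_linear_div_quadratic (A := 1) (B := 0) (p := 1) (q := 0) (r := δ ^ 2)
      tendsto_inv_atTop_zero (eventually_ne_atTop 0) one_ne_zero
    simpa using this

lemma integral_eq_setIntegral_Ioi_add_neg {g : ℝ → ℝ} (hg : Integrable g) :
    ∫ w, g w = ∫ w in Set.Ioi 0, (g w + g (-w)) := by
  rw [integral_add hg.integrableOn hg.comp_neg.integrableOn, integral_comp_neg_Ioi, neg_zero,
    ← setIntegral_union (by simp [Set.disjoint_left]) measurableSet_Iic hg.integrableOn
      hg.integrableOn]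
  simp [Set.union_comm]

lemma integral_hadamardKernel_mul_eq {r : ℝ → ℝ} (hr : Continuous r) {M : ℝ}
    (hM : ∀ u, |r u| ≤ M) (v : ℝ) {δ : ℝ} (hδ : δ ≠ 0) :
    ∫ w, hadamardKernel δ w * r (v + w) = ∫ w in Set.Ioi 0, hadamardKernel δ w * secDiff r v w := by
  have hi : Integrable fun w => hadamardKernel δ w * r (v + w) :=
    (integrable_hadamardKernel hδ).mul_bdd (c := M)
      (by fun_prop) (ae_of_all _ fun w => hM _)
  rw [integral_eq_setIntegral_Ioi_add_neg hi]
  have hk := (integrable_hadamardKernel hδ).integrableOn (s := Set.Ioi 0)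
  have h2 : IntegrableOn (fun w => hadamardKernel δ w * r (v + w) +
      hadamardKernel δ (-w) * r (v + -w)) (Set.Ioi 0) := (hi.add hi.comp_neg).integrableOn
  have h3 : ∫ w in Set.Ioi 0, hadamardKernel δ w * secDiff r v w =
      ∫ w in Set.Ioi 0, ((hadamardKernel δ w * r (v + w) +
      hadamardKernel δ (-w) * r (v + -w)) - hadamardKernel δ w * (2 * r v)) := by
    congr 1; ext w; rw [hadamardKernel_neg, secDiff, ← sub_eq_add_neg]; ring
  rw [h3, integral_sub h2 (hk.mul_const _), integral_mul_const, setIntegral_Ioi_hadamardKernel hδ]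
  ring

lemma abs_hadamardKernel_mul_secDiff_le {r : ℝ → ℝ} {v K b : ℝ}
    (hA : ∀ w > 0, |secDiff r v w| ≤ K * lineModulus b w) {δ : ℝ} (hδ : δ ≠ 0) {w : ℝ}
    (hw : 0 < w) : |hadamardKernel δ w * secDiff r v w| ≤ K * (lineModulus b w / w ^ 2) := by
  rw [abs_mul, ← mul_div_assoc, div_eq_inv_mul]
  refine mul_le_mul ((abs_hadamardKernel_le hδ w).trans (inv_anti₀ (by positivity) ?_)) (hA w hw)
    (abs_nonneg _) (by positivity)
  nlinarith [sq_nonneg δ]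

lemma abs_setIntegral_hadamardKernel_mul_secDiff_le {r : ℝ → ℝ} {v K b : ℝ} (hb : 0 < b)
    (hA : ∀ w > 0, |secDiff r v w| ≤ K * lineModulus b w) {δ : ℝ} (hδ : δ ≠ 0) :
    |∫ w in Set.Ioi 0, hadamardKernel δ w * secDiff r v w| ≤
      K * ∫ w in Set.Ioi 0, lineModulus b w / w ^ 2 := by
  rw [← integral_const_mul, ← Real.norm_eq_abs]
  refine norm_integral_le_of_norm_le ((integrableOn_lineModulus_div_sq hb).const_mul K) ?_
  filter_upwards [ae_restrict_mem measurableSet_Ioi] with w hw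
  exact abs_hadamardKernel_mul_secDiff_le hA hδ hw

lemma tendsto_setIntegral_hadamardKernel_mul_secDiff {r : ℝ → ℝ} (hr : Continuous r) {v K b : ℝ}
    (hb : 0 < b) (hA : ∀ w > 0, |secDiff r v w| ≤ K * lineModulus b w) :
    Tendsto (fun δ => ∫ w in Set.Ioi 0, hadamardKernel δ w * secDiff r v w) (𝓝[≠] 0)
      (𝓝 (-∫ w in Set.Ioi 0, secDiff r v w / w ^ 2)) := by
  rw [← integral_neg]
  refine tendsto_integral_filter_of_dominated_convergence
    (fun w => K * (lineModulus b w / w ^ 2)) ?_ ?_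
    ((integrableOn_lineModulus_div_sq hb).const_mul K) ?_
  · filter_upwards [self_mem_nhdsWithin] with δ hδ
    exact ((continuous_hadamardKernel hδ).mul (continuous_secDiff hr v)).aestronglyMeasurable
  · filter_upwards [self_mem_nhdsWithin] with δ hδ
    filter_upwards [ae_restrict_mem measurableSet_Ioi] with w hw
    exact abs_hadamardKernel_mul_secDiff_le hA hδ hw
  · filter_upwards [ae_restrict_mem measurableSet_Ioi] with w hw
    have hw : 0 < w := hw
    have hc : ContinuousAt (fun δ => hadamardKernel δ w * secDiff r v w) 0 := by
      unfold hadamardKernel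
      refine ContinuousAt.mul (ContinuousAt.div (by fun_prop) (by fun_prop) ?_) continuousAt_const
      positivity
    have := hc.tendsto.mono_left (nhdsWithin_le_nhds (s := {0}ᶜ))
    convert this using 2
    simp only [hadamardKernel]; field_simp; ring

lemma abs_hadamardKernel_sqrt_le {δ : ℝ} (hδ : δ ≠ 0) (s w : ℝ) :
    |hadamardKernel (δ * √(1 + s ^ 2)) w| ≤ (δ ^ 2)⁻¹ * (1 + s ^ 2)⁻¹ := by
  refine (abs_hadamardKernel_le' (mul_ne_zero hδ (by positivity)) w).trans_eq ?_
  rw [mul_pow, Real.sq_sqrt (by positivity), mul_inv]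

lemma hadamardKernel_sqrt (δ s w : ℝ) : hadamardKernel (δ * √(1 + s ^ 2)) w =
    (δ ^ 2 * (1 + s ^ 2) - w ^ 2) / (w ^ 2 + δ ^ 2 * (1 + s ^ 2)) ^ 2 := by
  rw [hadamardKernel, mul_pow, Real.sq_sqrt (by positivity)]

lemma integral_hadamardKernel_line {δ : ℝ} (hδ : 0 < δ) (T Z : ℝ) :
    ∫ s, hadamardKernel (δ * √(1 + s ^ 2)) (Z - s * T) =
      Real.pi * δ / √(δ ^ 2 + T ^ 2 + Z ^ 2) ^ 3 := by
  set ρ := √(δ ^ 2 + T ^ 2 + Z ^ 2) with hρ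
  have hρ2 : ρ ^ 2 = δ ^ 2 + T ^ 2 + Z ^ 2 := Real.sq_sqrt (by positivity)
  have hρ0 : 0 < ρ := Real.sqrt_pos.2 (by positivity)
  set a := T ^ 2 + δ ^ 2 with ha
  have ha0 : 0 < a := by positivity
  set e := δ ^ 2 / ρ ^ 2 with he
  set A := e - (δ ^ 2 - T ^ 2) / a with hA
  set B := -(Z * T * (1 + e) / a) with hB
  have hQ : ∀ s : ℝ, 0 < (Z - s * T) ^ 2 + δ ^ 2 * (1 + s ^ 2) := fun s => by positivity
  have hd : ∀ s : ℝ, HasDerivAt (fun s => (A * s + B) / ((Z - s * T) ^ 2 + δ ^ 2 * (1 + s ^ 2)) +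
      δ / ρ ^ 3 * Real.arctan ((a * s - Z * T) / (δ * ρ)))
      (hadamardKernel (δ * √(1 + s ^ 2)) (Z - s * T)) s := by
    intro s
    have h1 : HasDerivAt (fun s : ℝ => A * s + B) A s := by
      simpa using ((hasDerivAt_id s).const_mul A).add_const B
    have h2 : HasDerivAt (fun s : ℝ => (Z - s * T) ^ 2 + δ ^ 2 * (1 + s ^ 2))
        (2 * (Z - s * T) * (-T) + δ ^ 2 * (2 * s)) s := by
      have e1 := (((hasDerivAt_id' s).mul_const T).const_sub Z).pow 2
      have e2 := ((hasDerivAt_pow 2 s).const_add 1).const_mul (δ ^ 2)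
      refine (e1.add e2).congr_deriv ?_
      norm_num
    have h3 : HasDerivAt (fun s : ℝ => (a * s - Z * T) / (δ * ρ)) (a / (δ * ρ)) s := by
      simpa using (((hasDerivAt_id s).const_mul a).sub_const (Z * T)).div_const (δ * ρ)
    refine ((h1.div h2 (hQ s).ne').add (h3.arctan.const_mul (δ / ρ ^ 3))).congr_deriv ?_
    have hat : 1 + ((a * s - Z * T) / (δ * ρ)) ^ 2 =
        a * ((Z - s * T) ^ 2 + δ ^ 2 * (1 + s ^ 2)) / (δ * ρ) ^ 2 := by
      rw [eq_div_iff (by positivity), add_mul, div_pow, div_mul_cancel₀ _ (by positivity), mul_pow,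
        hρ2, ha]
      ring
    rw [hadamardKernel_sqrt, hat]
    have hE : δ / ρ ^ 3 * (1 / (a * ((Z - s * T) ^ 2 + δ ^ 2 * (1 + s ^ 2)) / (δ * ρ) ^ 2) *
        (a / (δ * ρ))) = e / ((Z - s * T) ^ 2 + δ ^ 2 * (1 + s ^ 2)) := by
      have := hQ s
      rw [he]; field_simp
    rw [hE]
    have := hQ s
    rw [← mul_div_mul_right e _ this.ne', ← sq, ← add_div]
    congr 1
    have e1 : e * (δ ^ 2 + T ^ 2 + Z ^ 2) = δ ^ 2 := by
      rw [he, ← hρ2, div_mul_cancel₀ _ (by positivity)]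
    have e2 : A * a = e * a - (δ ^ 2 - T ^ 2) := by rw [hA]; field_simp
    have e3 : B * a = - (Z * T * (1 + e)) := by rw [hB]; field_simp
    have e4 : a ≠ 0 := ha0.ne'
    apply mul_right_cancel₀ e4
    clear_value A B e a
    subst ha
    linear_combination ((Z - s * T) ^ 2 + δ ^ 2 * (1 + s ^ 2) -
      s * (2 * (Z - s * T) * (-T) + δ ^ 2 * (2 * s))) * e2 -
      (2 * (Z - s * T) * (-T) + δ ^ 2 * (2 * s)) * e3 + 2 * δ ^ 2 * e1
  have hrat : ∀ l : Filter ℝ, Tendsto (fun s : ℝ => s⁻¹) l (𝓝 0) → (∀ᶠ s in l, s ≠ 0) →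
      Tendsto (fun s => (A * s + B) / ((Z - s * T) ^ 2 + δ ^ 2 * (1 + s ^ 2))) l (𝓝 0) := by
    intro l hl hl0
    refine (tendsto_linear_div_quadratic hl hl0 (A := A) (B := B) (p := a) (q := -(2 * Z * T))
      (r := Z ^ 2 + δ ^ 2) ha0.ne').congr fun s => ?_
    congr 1; rw [ha]; ring
  have hδρ : 0 < δ * ρ := by positivity
  have htop : Tendsto (fun s => (a * s - Z * T) / (δ * ρ)) atTop atTop :=
    (tendsto_atTop_add_const_right _ (-(Z * T)) (tendsto_id.const_mul_atTop ha0)).atTop_div_const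
      hδρ
  have hbot : Tendsto (fun s => (a * s - Z * T) / (δ * ρ)) atBot atBot :=
    (tendsto_atBot_add_const_right _ (-(Z * T)) (tendsto_id.const_mul_atBot ha0)).atBot_div_const
      hδρ
  have l1 := (hrat atTop tendsto_inv_atTop_zero (eventually_ne_atTop 0)).add
    (((Real.tendsto_arctan_atTop.mono_right nhdsWithin_le_nhds).comp htop).const_mul (δ / ρ ^ 3))
  have l2 := (hrat atBot tendsto_inv_atBot_zero (eventually_ne_atBot 0)).add
    (((Real.tendsto_arctan_atBot.mono_right nhdsWithin_le_nhds).comp hbot).const_mul (δ / ρ ^ 3))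
  have hi : Integrable fun s => hadamardKernel (δ * √(1 + s ^ 2)) (Z - s * T) := by
    refine (integrable_inv_one_add_sq.const_mul (δ ^ 2)⁻¹).mono' ?_
      (ae_of_all _ fun s => abs_hadamardKernel_sqrt_le hδ.ne' s _)
    unfold hadamardKernel
    exact Measurable.aestronglyMeasurable (by fun_prop)
  rw [integral_of_hasDerivAt_of_tendsto hd hi l2 l1]
  field_simp
  ring

/-- The normalised planar Poisson kernel. -/
noncomputable def planePoisson (p : ℝ × ℝ) : ℝ :=
  (2 * Real.pi)⁻¹ * (√(1 + p.1 ^ 2 + p.2 ^ 2) ^ 3)⁻¹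

lemma hasDerivAt_div_sqrt {q : ℝ} (hq : 0 < q) (z : ℝ) :
    HasDerivAt (fun z => q⁻¹ * (z / √(q + z ^ 2))) (√(q + z ^ 2) ^ 3)⁻¹ z := by
  have hQ : 0 < q + z ^ 2 := by positivity
  have h0 : 0 < √(q + z ^ 2) := Real.sqrt_pos.2 hQ
  have h1 := ((hasDerivAt_pow 2 z).const_add q).sqrt hQ.ne'
  refine (((hasDerivAt_id' z).div h1 h0.ne').const_mul q⁻¹).congr_deriv ?_
  have h2 : √(q + z ^ 2) ^ 2 = q + z ^ 2 := Real.sq_sqrt hQ.le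
  field_simp
  rw [h2]
  norm_num
  ring

lemma tendsto_div_sqrt_atTop (q : ℝ) :
    Tendsto (fun z : ℝ => z / √(q + z ^ 2)) atTop (𝓝 1) := by
  have h1 : Tendsto (fun z : ℝ => (√(q * z⁻¹ ^ 2 + 1))⁻¹) atTop (𝓝 (√(q * 0 ^ 2 + 1))⁻¹) :=
    Tendsto.inv₀ (((tendsto_inv_atTop_zero.pow 2).const_mul q).add_const 1).sqrt (by simp)
  have e : (√(q * 0 ^ 2 + 1))⁻¹ = 1 := by simp
  rw [e] at h1
  refine h1.congr' ?_
  filter_upwards [eventually_gt_atTop 0] with z hz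
  have : q + z ^ 2 = (q * z⁻¹ ^ 2 + 1) * z ^ 2 := by field_simp
  rw [this, Real.sqrt_mul' _ (sq_nonneg z), Real.sqrt_sq hz.le, div_mul_cancel_right₀ hz.ne']

lemma integrable_inv_sqrt_cube {q : ℝ} (hq : 1 ≤ q) :
    Integrable fun z : ℝ => (√(q + z ^ 2) ^ 3)⁻¹ := by
  refine integrable_inv_one_add_sq.mono' (Measurable.aestronglyMeasurable (by fun_prop))
    (ae_of_all _ fun z => ?_)
  rw [Real.norm_of_nonneg (by positivity)]
  refine inv_anti₀ (by positivity) ?_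
  have h1 : 1 ≤ √(q + z ^ 2) := Real.one_le_sqrt.2 (by nlinarith [sq_nonneg z])
  have h2 : √(q + z ^ 2) ^ 2 = q + z ^ 2 := Real.sq_sqrt (by positivity)
  calc 1 + z ^ 2 ≤ √(q + z ^ 2) ^ 2 := by rw [h2]; linarith
    _ ≤ √(q + z ^ 2) ^ 3 := pow_le_pow_right₀ h1 (by norm_num)

lemma integral_inv_sqrt_cube {q : ℝ} (hq : 1 ≤ q) :
    ∫ z : ℝ, (√(q + z ^ 2) ^ 3)⁻¹ = 2 * q⁻¹ := by
  have l1 := (tendsto_div_sqrt_atTop q).const_mul q⁻¹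
  have l2 : Tendsto (fun z : ℝ => q⁻¹ * (z / √(q + z ^ 2))) atBot (𝓝 (q⁻¹ * -1)) := by
    have := ((tendsto_div_sqrt_atTop q).comp tendsto_neg_atBot_atTop).neg.const_mul q⁻¹
    refine this.congr fun z => ?_
    simp [neg_div]
  rw [integral_of_hasDerivAt_of_tendsto (hasDerivAt_div_sqrt (by linarith))
    (integrable_inv_sqrt_cube hq) l2 l1]
  ring

lemma integral_planePoisson : ∫ p, planePoisson p = 1 := by
  unfold planePoisson
  rw [integral_const_mul]
  have hq : ∀ x : ℝ, 1 ≤ 1 + x ^ 2 := fun x => by nlinarith [sq_nonneg x]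
  have hi : Integrable fun p : ℝ × ℝ => (√(1 + p.1 ^ 2 + p.2 ^ 2) ^ 3)⁻¹ := by
    refine (integrable_prod_iff (Measurable.aestronglyMeasurable (by fun_prop))).2
      ⟨ae_of_all _ fun x => integrable_inv_sqrt_cube (hq x), ?_⟩
    have : ∀ x y : ℝ, ‖(√(1 + x ^ 2 + y ^ 2) ^ 3)⁻¹‖ = (√(1 + x ^ 2 + y ^ 2) ^ 3)⁻¹ :=
      fun x y => Real.norm_of_nonneg (by positivity)
    simp_rw [this, integral_inv_sqrt_cube (hq _)]
    exact integrable_inv_one_add_sq.const_mul 2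
  rw [Measure.volume_eq_prod, integral_prod _ hi]
  simp_rw [integral_inv_sqrt_cube (hq _)]
  rw [integral_const_mul, integral_univ_inv_one_add_sq]
  field_simp

lemma tendsto_norm_sq_mul_planePoisson :
    Tendsto (fun p : ℝ × ℝ => ‖p‖ ^ 2 * planePoisson p) (Bornology.cobounded (ℝ × ℝ)) (𝓝 0) := by
  have h1 : Tendsto (fun p : ℝ × ℝ => (2 * Real.pi)⁻¹ * ‖p‖⁻¹) (Bornology.cobounded (ℝ × ℝ))
      (𝓝 ((2 * Real.pi)⁻¹ * 0)) :=
    (tendsto_inv_atTop_zero.comp tendsto_norm_cobounded_atTop).const_mul _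
  rw [mul_zero] at h1
  refine squeeze_zero' (Eventually.of_forall fun p => ?_) ?_ h1
  · unfold planePoisson; positivity
  · filter_upwards [tendsto_norm_cobounded_atTop.eventually_gt_atTop 0] with p hp
    unfold planePoisson
    rw [mul_left_comm]
    gcongr
    have h2 : ‖p‖ ≤ √(1 + p.1 ^ 2 + p.2 ^ 2) := by
      apply Real.le_sqrt_of_sq_le
      rw [Prod.norm_def, Real.norm_eq_abs, Real.norm_eq_abs]
      rcases max_choice |p.1| |p.2| with h | h <;> rw [h, sq_abs] <;> nlinarith [sq_nonneg p.1, sq_nonneg p.2]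
    calc ‖p‖ ^ 2 * (√(1 + p.1 ^ 2 + p.2 ^ 2) ^ 3)⁻¹ ≤ ‖p‖ ^ 2 * (‖p‖ ^ 3)⁻¹ := by gcongr
      _ = ‖p‖⁻¹ := by field_simp

lemma tendsto_integral_planePoisson {g : ℝ × ℝ → ℝ} (hg : Integrable g) {x₀ : ℝ × ℝ}
    (hc : ContinuousAt g x₀) :
    Tendsto (fun δ : ℝ => ∫ p, g p *
      (Real.pi * δ / √(δ ^ 2 + (p.1 - x₀.1) ^ 2 + (p.2 - x₀.2) ^ 2) ^ 3)) (𝓝[>] 0)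
      (𝓝 (2 * Real.pi ^ 2 * g x₀)) := by
  have hfin : Module.finrank ℝ (ℝ × ℝ) = 2 := by simp
  have h1 := tendsto_integral_comp_smul_smul_of_integrable' (μ := (volume : Measure (ℝ × ℝ)))
    (φ := planePoisson) (fun p => by unfold planePoisson; positivity) integral_planePoisson
    (by rw [hfin]; exact tendsto_norm_sq_mul_planePoisson) hg hc
  rw [hfin] at h1
  have h2 := (h1.comp tendsto_inv_nhdsGT_zero).const_mul (2 * Real.pi ^ 2)
  refine h2.congr' ?_
  filter_upwards [self_mem_nhdsWithin] with δ hδ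
  have hδ : 0 < δ := hδ
  rw [Function.comp_apply, ← integral_const_mul]
  congr 1; ext p
  have : 1 + (δ⁻¹ * (x₀.1 - p.1)) ^ 2 + (δ⁻¹ * (x₀.2 - p.2)) ^ 2 =
      (δ ^ 2 + (p.1 - x₀.1) ^ 2 + (p.2 - x₀.2) ^ 2) / δ ^ 2 := by
    field_simp; ring
  simp only [planePoisson, Prod.smul_fst, Prod.smul_snd, Prod.fst_sub, Prod.snd_sub, smul_eq_mul]
  rw [this, Real.sqrt_div' _ (sq_nonneg δ), Real.sqrt_sq hδ.le]
  field_simp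

/-- The dual plane integral of `F` against the regularised kernel on the line of slope `s`
through `(t₀, z₀)`. -/
noncomputable def regularizedLine (F : ℝ → ℝ → ℝ) (t₀ z₀ δ s : ℝ) : ℝ :=
  ∫ p : ℝ × ℝ, F p.1 p.2 * hadamardKernel (δ * √(1 + s ^ 2)) (p.2 - z₀ - s * (p.1 - t₀))

lemma integrable_mul_hadamardKernel {F : ℝ → ℝ → ℝ} (hF : Integrable (Function.uncurry F))
    {δ : ℝ} (hδ : δ ≠ 0) {θ : ℝ × ℝ → ℝ} (hθ : Continuous θ) :
    Integrable fun p : ℝ × ℝ => F p.1 p.2 * hadamardKernel δ (θ p) :=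
  hF.mul_bdd (c := (δ ^ 2)⁻¹) ((continuous_hadamardKernel hδ).comp hθ).aestronglyMeasurable
    (ae_of_all _ fun _ => abs_hadamardKernel_le' hδ _)

lemma regularizedLine_eq {F : ℝ → ℝ → ℝ} (hF : Integrable (Function.uncurry F)) (t₀ z₀ s : ℝ)
    {δ : ℝ} (hδ : δ ≠ 0) :
    regularizedLine F t₀ z₀ δ s =
      ∫ w, hadamardKernel (δ * √(1 + s ^ 2)) w * lineInt F s (z₀ - s * t₀ + w) := by
  set σ := δ * √(1 + s ^ 2)
  have hσ : σ ≠ 0 := mul_ne_zero hδ (by positivity)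
  have hi := integrable_mul_hadamardKernel hF hσ
    (θ := fun p => p.2 - z₀ - s * (p.1 - t₀)) (by fun_prop)
  have hi' := hi.comp_shear (H := fun t z => F t z * hadamardKernel σ (z - z₀ - s * (t - t₀))) s
  have e1 : regularizedLine F t₀ z₀ δ s = ∫ p : ℝ × ℝ, F p.1 (s * p.1 + p.2) *
      hadamardKernel σ (s * p.1 + p.2 - z₀ - s * (p.1 - t₀)) := by
    rw [regularizedLine]
    conv_lhs => rw [← (measurePreserving_shear s).map_eq]
    rw [integral_map (measurePreserving_shear s).measurable.aemeasurable]
    rw [(measurePreserving_shear s).map_eq]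
    exact hi.aestronglyMeasurable
  rw [e1, Measure.volume_eq_prod, integral_prod_symm _ hi',
    ← integral_add_left_eq_self (μ := volume) _ (z₀ - s * t₀)]
  congr 1; ext w
  rw [lineInt, ← integral_const_mul]
  congr 1; ext t
  rw [mul_comm]
  congr 2
  ring

lemma stronglyMeasurable_regularizedLine {F : ℝ → ℝ → ℝ} (hF : Measurable (Function.uncurry F))
    (t₀ z₀ δ : ℝ) : StronglyMeasurable (regularizedLine F t₀ z₀ δ) := by
  have : Measurable fun q : ℝ × ℝ × ℝ => F q.2.1 q.2.2 *
      hadamardKernel (δ * √(1 + q.1 ^ 2)) (q.2.2 - z₀ - q.1 * (q.2.1 - t₀)) := by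
    refine (hF.comp measurable_snd).mul ?_
    unfold hadamardKernel
    fun_prop
  exact this.stronglyMeasurable.integral_prod_right

lemma integral_regularizedLine {F : ℝ → ℝ → ℝ} (hF : Integrable (Function.uncurry F))
    (hFm : Measurable (Function.uncurry F)) (t₀ z₀ : ℝ) {δ : ℝ} (hδ : 0 < δ) :
    ∫ s, regularizedLine F t₀ z₀ δ s = ∫ p : ℝ × ℝ, F p.1 p.2 *
      (Real.pi * δ / √(δ ^ 2 + (p.1 - t₀) ^ 2 + (p.2 - z₀) ^ 2) ^ 3) := by
  unfold regularizedLine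
  rw [integral_integral_swap]
  · congr 1; ext p
    rw [integral_const_mul, integral_hadamardKernel_line hδ]
  · have hb : Integrable (fun q : ℝ × ℝ × ℝ => (δ ^ 2)⁻¹ * (1 + q.1 ^ 2)⁻¹ * |F q.2.1 q.2.2|)
        (volume.prod volume) :=
      (integrable_inv_one_add_sq.const_mul (δ ^ 2)⁻¹).mul_prod hF.abs
    refine hb.mono' ?_ (ae_of_all _ fun q => ?_)
    · refine Measurable.aestronglyMeasurable ((hFm.comp measurable_snd).mul ?_)
      unfold hadamardKernel
      fun_prop
    · simp only [Function.uncurry]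
      rw [Real.norm_eq_abs, abs_mul, mul_comm]
      gcongr
      exact abs_hadamardKernel_sqrt_le hδ.ne' _ _

lemma integrable_one_add_sq_rpow : Integrable fun s : ℝ => (1 + s ^ 2) ^ (-(3 / 4) : ℝ) := by
  have := integrable_rpow_neg_one_add_norm_sq (E := ℝ) (μ := volume) (r := 3 / 2)
    (by norm_num)
  convert this using 2 with s
  rw [Real.norm_eq_abs, sq_abs]
  norm_num

/-- Inversion of the line transform through Hilbert transforms of its derivative. -/
theorem IsQuadrantSymbol.integral_pv_deriv_lineInt {b C : ℝ} {F : ℝ → ℝ → ℝ}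
    (h : IsQuadrantSymbol b C F) (hb0 : 0 < b) (hb1 : b < 1) {t₀ z₀ : ℝ} (ht : 0 < t₀)
    (hz : 0 < z₀) :
    ∫ s, pv (fun u => deriv (lineInt F s) u / (z₀ - s * t₀ - u)) (z₀ - s * t₀) =
      2 * Real.pi ^ 2 * F t₀ z₀ := by
  obtain ⟨K, hK, hA⟩ := h.exists_abs_secDiff_le hb0 hb1 ht hz
  have hF := h.integrable hb0
  set M := ∫ w in Set.Ioi 0, lineModulus b w / w ^ 2
  have hA' : ∀ s ≠ 0, ∀ w > 0, |secDiff (lineInt F s) (z₀ - s * t₀) w| ≤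
      K * (1 + s ^ 2) ^ (-(3 / 4) : ℝ) * lineModulus b w := fun s hs w hw =>
    (hA s hs w hw).trans_eq (mul_assoc _ _ _).symm
  have hcont : ∀ s ≠ 0, Continuous (lineInt F s) := fun s hs =>
    continuous_iff_continuousAt.2 fun u => (h.hasDerivAt_lineInt hb0 hs u).continuousAt
  have hne : ∀ᵐ s : ℝ, s ≠ 0 := by simp [ae_iff]
  have hbdd := abs_lineInt_le (h.abs_le_right hb0.le)
  have hreg : ∀ s ≠ 0, ∀ δ ≠ 0, regularizedLine F t₀ z₀ δ s = ∫ w in Set.Ioi 0,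
      hadamardKernel (δ * √(1 + s ^ 2)) w * secDiff (lineInt F s) (z₀ - s * t₀) w := by
    intro s hs δ hδ
    rw [regularizedLine_eq hF t₀ z₀ s hδ, integral_hadamardKernel_mul_eq (hcont s hs) (hbdd s) _
      (mul_ne_zero hδ (by positivity))]
  have l1 : Tendsto (fun δ => ∫ s, regularizedLine F t₀ z₀ δ s) (𝓝[>] 0)
      (𝓝 (2 * Real.pi ^ 2 * F t₀ z₀)) := by
    have hc : ContinuousAt (Function.uncurry F) (t₀, z₀) :=
      h.continuousOn.continuousAt ((isOpen_Ioi.prod isOpen_Ioi).mem_nhds ⟨ht, hz⟩)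
    refine (tendsto_integral_planePoisson hF hc).congr' ?_
    filter_upwards [self_mem_nhdsWithin] with δ hδ
    exact (integral_regularizedLine hF h.measurable t₀ z₀ hδ).symm
  have l2 : Tendsto (fun δ => ∫ s, regularizedLine F t₀ z₀ δ s) (𝓝[>] 0)
      (𝓝 (∫ s, pv (fun u => deriv (lineInt F s) u / (z₀ - s * t₀ - u)) (z₀ - s * t₀))) := by
    refine tendsto_integral_filter_of_dominated_convergence
      (fun s => K * (1 + s ^ 2) ^ (-(3 / 4) : ℝ) * M)
      (Eventually.of_forall fun δ =>
        (stronglyMeasurable_regularizedLine h.measurable t₀ z₀ δ).aestronglyMeasurable)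
      ?_ ((integrable_one_add_sq_rpow.const_mul K).mul_const M) ?_
    · filter_upwards [self_mem_nhdsWithin] with δ hδ
      have hδ : δ ≠ 0 := ne_of_gt hδ
      filter_upwards [hne] with s hs
      rw [hreg s hs δ hδ]
      exact abs_setIntegral_hadamardKernel_mul_secDiff_le hb0 (hA' s hs)
        (mul_ne_zero hδ (by positivity))
    · filter_upwards [hne] with s hs
      rw [pv_deriv_eq (h.hasDerivAt_lineInt hb0 hs)
        (integrable_lineInt (h.integrable_derivSnd hb0) s) hb0 (hA' s hs)]
      have hlim : Tendsto (fun δ : ℝ => δ * √(1 + s ^ 2)) (𝓝[>] 0) (𝓝[≠] 0) := by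
        refine tendsto_nhdsWithin_iff.2 ⟨?_, ?_⟩
        · have : Tendsto (fun δ : ℝ => δ * √(1 + s ^ 2)) (𝓝 0) (𝓝 (0 * √(1 + s ^ 2))) :=
            tendsto_id.mul_const _
          rw [zero_mul] at this
          exact this.mono_left nhdsWithin_le_nhds
        · filter_upwards [self_mem_nhdsWithin] with δ hδ
          exact mul_ne_zero (ne_of_gt hδ) (by positivity)
      refine ((tendsto_setIntegral_hadamardKernel_mul_secDiff (hcont s hs) hb0
        (hA' s hs)).comp hlim).congr' ?_
      filter_upwards [self_mem_nhdsWithin] with δ hδ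
      exact (hreg s hs δ (ne_of_gt hδ)).symm
  exact tendsto_nhds_unique l2 l1

lemma SymbolBound.of_hasDerivAt {e C : ℝ} {h h' h'' : ℝ → ℝ}
    (h1 : ∀ x > 0, HasDerivAt h (h' x) x) (h2 : ∀ x > 0, HasDerivAt h' (h'' x) x)
    (b0 : ∀ x > 0, |h x| ≤ C * x ^ e) (b1 : ∀ x > 0, |h' x| ≤ C * x ^ (e - 1))
    (b2 : ∀ x > 0, |h'' x| ≤ C * x ^ (e - 2)) : SymbolBound e C h := by
  intro x hx
  have e1 : deriv h =ᶠ[𝓝 x] h' := by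
    filter_upwards [Ioi_mem_nhds hx] with y hy using (h1 y hy).deriv
  have e2 : HasDerivAt (deriv h) (h'' x) x := (h2 x hx).congr_of_eventuallyEq e1
  rw [e2.deriv, (h1 x hx).deriv]
  exact ⟨(h1 x hx).differentiableAt, e2.differentiableAt, b0 x hx, b1 x hx, b2 x hx⟩

lemma SymbolBound.congr {e C : ℝ} {h g : ℝ → ℝ} (H : SymbolBound e C h)
    (hg : ∀ x > 0, g x = h x) : SymbolBound e C g := by
  refine SymbolBound.of_hasDerivAt (h' := deriv h) (h'' := deriv (deriv h))
    (fun x hx => ?_) (fun x hx => (H x hx).2.1.hasDerivAt)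
    (fun x hx => by rw [hg x hx]; exact (H x hx).2.2.1) (fun x hx => (H x hx).2.2.2.1)
    (fun x hx => (H x hx).2.2.2.2)
  refine (H x hx).1.hasDerivAt.congr_of_eventuallyEq ?_
  filter_upwards [Ioi_mem_nhds hx] with y hy using hg y hy

lemma SymbolBound.mono {e C C' : ℝ} {h : ℝ → ℝ} (H : SymbolBound e C h) (hC : C ≤ C') :
    SymbolBound e C' h := by
  intro x hx
  obtain ⟨d1, d2, b0, b1, b2⟩ := H x hx
  exact ⟨d1, d2, b0.trans (by gcongr), b1.trans (by gcongr), b2.trans (by gcongr)⟩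

lemma SymbolBound.const_mul {e C : ℝ} {h : ℝ → ℝ} (H : SymbolBound e C h) (a : ℝ) :
    SymbolBound e (|a| * C) (fun x => a * h x) := by
  have hC := H.const_nonneg
  refine SymbolBound.of_hasDerivAt
    (fun x hx => (H x hx).1.hasDerivAt.const_mul a)
    (fun x hx => (H x hx).2.1.hasDerivAt.const_mul a) ?_ ?_ ?_ <;> intro x hx <;>
  · rw [abs_mul, mul_assoc]
    obtain ⟨-, -, b0, b1, b2⟩ := H x hx
    gcongr

lemma SymbolBound.rpow_mul {e C : ℝ} {h : ℝ → ℝ} (H : SymbolBound e C h) (r : ℝ) :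
    SymbolBound (e + r) ((2 + |r|) ^ 2 * C) (fun x => x ^ r * h x) := by
  have hC := H.const_nonneg
  have hd : ∀ q : ℝ, ∀ x : ℝ, 0 < x → HasDerivAt (fun x : ℝ => x ^ q) (q * x ^ (q - 1)) x :=
    fun q x hx => Real.hasDerivAt_rpow_const (Or.inl hx.ne')
  have hr : |r - 1| ≤ |r| + 1 := (abs_sub _ _).trans_eq (by simp)
  refine SymbolBound.of_hasDerivAt
    (fun x hx => (hd r x hx).mul (H x hx).1.hasDerivAt)
    (fun x hx => (((hd (r - 1) x hx).const_mul r).mul (H x hx).1.hasDerivAt).add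
      ((hd r x hx).mul (H x hx).2.1.hasDerivAt)) ?_ ?_ ?_ <;> intro x hx <;>
  obtain ⟨-, -, b0, b1, b2⟩ := H x hx <;> have hx : 0 < x := hx
  · have : |x ^ r * h x| ≤ x ^ r * (C * x ^ e) := by
      rw [abs_mul, abs_of_pos (by positivity : 0 < x ^ r)]; gcongr
    refine this.trans ?_
    rw [mul_left_comm, ← Real.rpow_add hx, add_comm r e]
    gcongr
    exact le_mul_of_one_le_left hC (one_le_pow₀ (by linarith [abs_nonneg r]))
  · have e1 : x ^ (r - 1) * x ^ e = x ^ (e + r - 1) := by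
      rw [← Real.rpow_add hx]; congr 1; ring
    have e2 : x ^ r * x ^ (e - 1) = x ^ (e + r - 1) := by
      rw [← Real.rpow_add hx]; congr 1; ring
    calc |r * x ^ (r - 1) * h x + x ^ r * deriv h x|
        ≤ |r| * x ^ (r - 1) * |h x| + x ^ r * |deriv h x| := by
          refine (abs_add_le _ _).trans_eq ?_
          simp only [abs_mul, abs_of_pos (Real.rpow_pos_of_pos hx _)]
      _ ≤ |r| * x ^ (r - 1) * (C * x ^ e) + x ^ r * (C * x ^ (e - 1)) := by gcongr
      _ = (|r| + 1) * C * x ^ (e + r - 1) := by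
          linear_combination (|r| * C) * e1 + C * e2
      _ ≤ _ := by gcongr; nlinarith [abs_nonneg r]
  · have e1 : x ^ (r - 1 - 1) * x ^ e = x ^ (e + r - 2) := by
      rw [← Real.rpow_add hx]; congr 1; ring
    have e2 : x ^ (r - 1) * x ^ (e - 1) = x ^ (e + r - 2) := by
      rw [← Real.rpow_add hx]; congr 1; ring
    have e3 : x ^ r * x ^ (e - 2) = x ^ (e + r - 2) := by
      rw [← Real.rpow_add hx]; congr 1; ring
    calc |r * ((r - 1) * x ^ (r - 1 - 1)) * h x + r * x ^ (r - 1) * deriv h x +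
          (r * x ^ (r - 1) * deriv h x + x ^ r * deriv (deriv h) x)|
        ≤ |r| * ((|r| + 1) * x ^ (r - 1 - 1)) * |h x| + |r| * x ^ (r - 1) * |deriv h x| +
          (|r| * x ^ (r - 1) * |deriv h x| + x ^ r * |deriv (deriv h) x|) := by
          refine (abs_add_le _ _).trans (add_le_add ((abs_add_le _ _).trans ?_)
            ((abs_add_le _ _).trans ?_)) <;>
          simp only [abs_mul, abs_of_pos (Real.rpow_pos_of_pos hx _)]
          · gcongr
          · exact le_rfl
      _ ≤ |r| * ((|r| + 1) * x ^ (r - 1 - 1)) * (C * x ^ e) +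
          |r| * x ^ (r - 1) * (C * x ^ (e - 1)) +
          (|r| * x ^ (r - 1) * (C * x ^ (e - 1)) + x ^ r * (C * x ^ (e - 2))) := by gcongr
      _ = (|r| * (|r| + 1) + 2 * |r| + 1) * C * x ^ (e + r - 2) := by
          linear_combination (|r| * (|r| + 1) * C) * e1 + 2 * (|r| * C) * e2 + C * e3
      _ ≤ _ := by gcongr; nlinarith [abs_nonneg r]

lemma SymbolBound.comp_rpow {e C : ℝ} {h : ℝ → ℝ} (H : SymbolBound e C h) {p : ℝ} (hp : 0 < p) :
    SymbolBound (p * e) (2 * (1 + p) ^ 2 * C) (fun x => h (x ^ p)) := by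
  have hC := H.const_nonneg
  have hd : ∀ q : ℝ, ∀ x : ℝ, 0 < x → HasDerivAt (fun x : ℝ => x ^ q) (q * x ^ (q - 1)) x :=
    fun q x hx => Real.hasDerivAt_rpow_const (Or.inl hx.ne')
  have hpos : ∀ x : ℝ, 0 < x → 0 < x ^ p := fun x hx => Real.rpow_pos_of_pos hx p
  have hp1 : |p - 1| ≤ p + 1 := (abs_sub _ _).trans_eq (by simp [abs_of_pos hp])
  refine SymbolBound.of_hasDerivAt
    (fun x hx => (H _ (hpos x hx)).1.hasDerivAt.comp x (hd p x hx))
    (fun x hx => ((H _ (hpos x hx)).2.1.hasDerivAt.comp x (hd p x hx)).mul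
      ((hd (p - 1) x hx).const_mul p)) ?_ ?_ ?_ <;> intro x hx <;>
  obtain ⟨-, -, b0, b1, b2⟩ := H _ (hpos x hx) <;> have hx : 0 < x := hx
  · rw [← Real.rpow_mul hx.le] at b0
    refine b0.trans ?_
    gcongr
    refine le_mul_of_one_le_left hC ?_
    nlinarith
  · rw [← Real.rpow_mul hx.le] at b1
    have e1 : x ^ (p * (e - 1)) * x ^ (p - 1) = x ^ (p * e - 1) := by
      rw [← Real.rpow_add hx]; congr 1; ring
    calc |deriv h (x ^ p) * (p * x ^ (p - 1))| = |deriv h (x ^ p)| * (p * x ^ (p - 1)) := by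
          rw [abs_mul, abs_of_pos (by positivity : 0 < p * x ^ (p - 1))]
      _ ≤ C * x ^ (p * (e - 1)) * (p * x ^ (p - 1)) := by gcongr
      _ = p * C * x ^ (p * e - 1) := by linear_combination (p * C) * e1
      _ ≤ _ := by gcongr; nlinarith
  · rw [← Real.rpow_mul hx.le] at b1 b2
    have e1 : x ^ (p * (e - 1)) * x ^ (p - 1 - 1) = x ^ (p * e - 2) := by
      rw [← Real.rpow_add hx]; congr 1; ring
    have e2 : x ^ (p * (e - 2)) * (x ^ (p - 1) * x ^ (p - 1)) = x ^ (p * e - 2) := by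
      rw [← Real.rpow_add hx, ← Real.rpow_add hx]; congr 1; ring
    calc |deriv (deriv h) (x ^ p) * (p * x ^ (p - 1)) * (p * x ^ (p - 1)) +
          deriv h (x ^ p) * (p * ((p - 1) * x ^ (p - 1 - 1)))|
        ≤ |deriv (deriv h) (x ^ p)| * (p * x ^ (p - 1)) * (p * x ^ (p - 1)) +
          |deriv h (x ^ p)| * (p * ((p + 1) * x ^ (p - 1 - 1))) := by
          refine (abs_add_le _ _).trans (add_le_add ?_ ?_) <;>
          simp only [abs_mul, abs_of_pos (Real.rpow_pos_of_pos hx _), abs_of_pos hp]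
          · exact le_rfl
          · gcongr
      _ ≤ C * x ^ (p * (e - 2)) * (p * x ^ (p - 1)) * (p * x ^ (p - 1)) +
          C * x ^ (p * (e - 1)) * (p * ((p + 1) * x ^ (p - 1 - 1))) := by gcongr
      _ = (p ^ 2 + p * (p + 1)) * C * x ^ (p * e - 2) := by
          linear_combination (p * (p + 1) * C) * e1 + (p ^ 2 * C) * e2
      _ ≤ _ := by gcongr; nlinarith

/-- The partial derivative in the first variable. -/
noncomputable def partialFst (g : 𝓢(ℝ × ℝ, ℝ)) : 𝓢(ℝ × ℝ, ℝ) := ∂_{((1, 0) : ℝ × ℝ)} g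

/-- The partial derivative in the second variable. -/
noncomputable def partialSnd (g : 𝓢(ℝ × ℝ, ℝ)) : 𝓢(ℝ × ℝ, ℝ) := ∂_{((0, 1) : ℝ × ℝ)} g

lemma hasDerivAt_partialFst (g : 𝓢(ℝ × ℝ, ℝ)) (x y : ℝ) :
    HasDerivAt (fun x => g (x, y)) (partialFst g (x, y)) x := by
  rw [partialFst, SchwartzMap.lineDerivOp_apply_eq_fderiv]
  exact (g.hasFDerivAt (x, y)).comp_hasDerivAt x ((hasDerivAt_id x).prodMk (hasDerivAt_const x y))

lemma hasDerivAt_partialSnd (g : 𝓢(ℝ × ℝ, ℝ)) (x y : ℝ) :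
    HasDerivAt (fun y => g (x, y)) (partialSnd g (x, y)) y := by
  rw [partialSnd, SchwartzMap.lineDerivOp_apply_eq_fderiv]
  exact (g.hasFDerivAt (x, y)).comp_hasDerivAt y ((hasDerivAt_const y x).prodMk (hasDerivAt_id y))

lemma partialFst_partialSnd (g : 𝓢(ℝ × ℝ, ℝ)) :
    partialFst (partialSnd g) = partialSnd (partialFst g) := by
  have key : ∀ (v w p : ℝ × ℝ), fderiv ℝ (∂_{v} g : 𝓢(ℝ × ℝ, ℝ)) p w = fderiv ℝ (fderiv ℝ g) p w v := by
    intro v w p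
    have hd : DifferentiableAt ℝ (fderiv ℝ g) p :=
      ((g.smooth 2).fderiv_right (m := 1) (by norm_num)).differentiable (by norm_num) p
    have e : ⇑(∂_{v} g : 𝓢(ℝ × ℝ, ℝ)) = fun q => fderiv ℝ g q v := by
      ext q; exact SchwartzMap.lineDerivOp_apply_eq_fderiv v g q
    rw [e, fderiv_clm_apply hd (differentiableAt_const v)]
    simp
  ext p
  simp only [partialFst, partialSnd]
  rw [SchwartzMap.lineDerivOp_apply_eq_fderiv, SchwartzMap.lineDerivOp_apply_eq_fderiv, key, key]
  exact ((g.smooth 2).contDiffAt.isSymmSndFDerivAt (by simp)).eq _ _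

lemma iteratedDeriv_fst (g : 𝓢(ℝ × ℝ, ℝ)) (k : ℕ) (x y : ℝ) :
    iteratedDeriv k (fun x => g (x, y)) x = partialFst^[k] g (x, y) := by
  induction k generalizing g with
  | zero => simp
  | succ k ih =>
    rw [iteratedDeriv_succ', Function.iterate_succ_apply, ← ih]
    congr 1; ext x
    exact (hasDerivAt_partialFst g x y).deriv

/-- `g` vanishes to order `n` on the line `x = c`. -/
def VanishesToOrder (n : ℕ) (c : ℝ) (g : 𝓢(ℝ × ℝ, ℝ)) : Prop :=
  ∀ k < n, ∀ y : ℝ, partialFst^[k] g (c, y) = 0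

lemma VanishesToOrder.partialSnd {n : ℕ} {c : ℝ} {g : 𝓢(ℝ × ℝ, ℝ)} (h : VanishesToOrder n c g) :
    VanishesToOrder n c (partialSnd g) := by
  intro k hk y
  have hc : Function.Commute partialFst _root_.partialSnd := partialFst_partialSnd
  rw [(hc.iterate_left k).eq g, ← (hasDerivAt_partialSnd _ c y).deriv]
  simp [h k hk]

lemma VanishesToOrder.partialFst {n : ℕ} {c : ℝ} {g : 𝓢(ℝ × ℝ, ℝ)} (h : VanishesToOrder n c g) :
    VanishesToOrder (n - 1) c (partialFst g) := fun k hk y => by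
  rw [← Function.iterate_succ_apply]
  exact h (k + 1) (by omega) y

lemma exists_abs_le_decay (g : 𝓢(ℝ × ℝ, ℝ)) (c : ℝ) (M N : ℕ) :
    ∃ D ≥ 0, ∀ x y : ℝ, |g (c + x, y)| ≤ D * ((1 + |x|) ^ M)⁻¹ * ((1 + |y|) ^ N)⁻¹ := by
  obtain ⟨D, hD⟩ : ∃ D, ∀ p : ℝ × ℝ, (1 + ‖p‖) ^ (M + N) * |g p| ≤ D := by
    refine ⟨2 ^ (M + N) * (Finset.Iic (M + N, 0)).sup
      (fun m => SchwartzMap.seminorm ℝ m.1 m.2) g, fun p => ?_⟩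
    have := SchwartzMap.one_add_le_sup_seminorm_apply (𝕜 := ℝ) (m := (M + N, 0)) le_rfl le_rfl g p
    simpa only [norm_iteratedFDeriv_zero, Real.norm_eq_abs] using this
  have hD0 : 0 ≤ D := le_trans (by positivity) (hD 0)
  refine ⟨(1 + |c|) ^ M * D, by positivity, fun x y => ?_⟩
  rw [← div_eq_mul_inv, ← div_eq_mul_inv, div_div, le_div_iff₀ (by positivity)]
  set p : ℝ × ℝ := (c + x, y) with hp
  have h1 : |c + x| ≤ ‖p‖ := norm_fst_le p
  have h2 : |y| ≤ ‖p‖ := norm_snd_le p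
  have h3 : 1 + |x| ≤ (1 + |c|) * (1 + ‖p‖) := by
    have : |x| ≤ |c + x| + |c| := by
      calc |x| = |(c + x) - c| := by ring_nf
        _ ≤ _ := abs_sub _ _
    nlinarith [abs_nonneg c, norm_nonneg p]
  calc |g p| * ((1 + |x|) ^ M * (1 + |y|) ^ N)
      ≤ |g p| * (((1 + |c|) * (1 + ‖p‖)) ^ M * (1 + ‖p‖) ^ N) := by gcongr
    _ = (1 + |c|) ^ M * ((1 + ‖p‖) ^ (M + N) * |g p|) := by rw [mul_pow, pow_add]; ring
    _ ≤ _ := by gcongr; exact hD p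

lemma VanishesToOrder.exists_abs_le_pow {n : ℕ} {c : ℝ} {g : 𝓢(ℝ × ℝ, ℝ)}
    (h : VanishesToOrder n c g) (N : ℕ) :
    ∃ D ≥ 0, ∀ x ≥ 0, ∀ y : ℝ, |g (c + x, y)| ≤ D * x ^ n * ((1 + |y|) ^ N)⁻¹ := by
  induction n generalizing g with
  | zero =>
    obtain ⟨D, hD, H⟩ := exists_abs_le_decay g c 0 N
    exact ⟨D, hD, fun x _ y => by simpa using H x y⟩
  | succ n ih =>
    obtain ⟨D, hD, H⟩ := ih h.partialFst
    refine ⟨D, hD, fun x hx y => ?_⟩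
    have h0 : g (c, y) = 0 := h 0 (Nat.succ_pos n) y
    have hd : ∀ ξ ∈ Set.Icc 0 x, HasDerivWithinAt (fun ξ => g (c + ξ, y))
        (_root_.partialFst g (c + ξ, y)) (Set.Icc 0 x) ξ := fun ξ _ =>
      ((hasDerivAt_partialFst g (c + ξ) y).comp_const_add c ξ).hasDerivWithinAt
    have := (convex_Icc 0 x).norm_image_sub_le_of_norm_hasDerivWithin_le hd
      (C := D * x ^ n * ((1 + |y|) ^ N)⁻¹) (fun ξ hξ => (H ξ hξ.1 y).trans (by
        have := hξ.1
        gcongr; exact hξ.2)) (x := 0) (y := x)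
      ⟨le_rfl, hx⟩ ⟨hx, le_rfl⟩
    simp only [add_zero, h0, sub_zero, Real.norm_eq_abs, abs_of_nonneg hx] at this
    exact this.trans_eq (by rw [pow_succ]; ring)

lemma one_add_rpow_sq_le {x a : ℝ} (hx : 0 < x) (ha : 0 ≤ a) {N : ℕ} (hN : 2 * a ≤ N) :
    (1 + x ^ a) ^ 2 ≤ 4 * (1 + x) ^ N := by
  have h1 : (1 : ℝ) ≤ (1 + x) ^ a := Real.one_le_rpow (by linarith) ha
  have h2 : x ^ a ≤ (1 + x) ^ a := Real.rpow_le_rpow hx.le (by linarith) ha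
  have h3 : ((1 + x) ^ a) ^ 2 ≤ (1 + x) ^ N := by
    rw [← Real.rpow_mul_natCast (by linarith), ← Real.rpow_natCast (1 + x) N]
    apply Real.rpow_le_rpow_of_exponent_le (by linarith)
    push_cast; linarith
  have h4 : (1 + x ^ a) ^ 2 ≤ (2 * (1 + x) ^ a) ^ 2 := by
    have : 0 ≤ x ^ a := by positivity
    gcongr; linarith
  nlinarith

lemma VanishesToOrder.exists_abs_le_rpow {n : ℕ} {c : ℝ} {g : 𝓢(ℝ × ℝ, ℝ)}
    (h : VanishesToOrder n c g) (N : ℕ) {e a : ℝ} (he : e ≤ n) (ha : 0 ≤ a) :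
    ∃ D ≥ 0, ∀ x > 0, ∀ y : ℝ,
      |g (c + x, y)| ≤ D * x ^ e * ((1 + x ^ a) ^ 2)⁻¹ * ((1 + |y|) ^ N)⁻¹ := by
  obtain ⟨D₁, hD₁, H₁⟩ := h.exists_abs_le_pow N
  set L := ⌈2 * a⌉₊
  set P := ⌈|e|⌉₊
  obtain ⟨D₂, hD₂, H₂⟩ := exists_abs_le_decay g c (P + L) N
  refine ⟨4 * (D₁ + D₂), by positivity, fun x hx y => ?_⟩
  have hx : 0 < x := hx
  have hxa : 0 < x ^ a := by positivity
  rcases le_or_gt x 1 with hx1 | hx1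
  · refine (H₁ x hx.le y).trans ?_
    gcongr ?_ * _
    rw [← div_eq_mul_inv, le_div_iff₀ (by positivity)]
    have h1 : x ^ n ≤ x ^ e := by
      rw [← Real.rpow_natCast]
      exact Real.rpow_le_rpow_of_exponent_ge hx hx1 he
    have h2 : (1 + x ^ a) ^ 2 ≤ 4 := by
      have := Real.rpow_le_one hx.le hx1 ha
      nlinarith
    calc D₁ * x ^ n * (1 + x ^ a) ^ 2 ≤ (D₁ + D₂) * x ^ e * 4 := by gcongr; linarith
      _ = _ := by ring
  · refine (H₂ x y).trans ?_
    gcongr ?_ * _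
    rw [abs_of_pos hx, ← div_eq_mul_inv, ← div_eq_mul_inv, le_div_iff₀ (by positivity),
      div_mul_eq_mul_div, div_le_iff₀ (by positivity)]
    have h1 := one_add_rpow_sq_le hx ha (Nat.le_ceil (2 * a))
    have h2 : 1 ≤ x ^ e * (1 + x) ^ P := by
      have : x ^ (-e) ≤ (1 + x) ^ P := by
        calc x ^ (-e) ≤ x ^ (P : ℝ) := by
              apply Real.rpow_le_rpow_of_exponent_le hx1.le
              exact (neg_le_abs e).trans (Nat.le_ceil _)
          _ = x ^ P := Real.rpow_natCast _ _
          _ ≤ _ := by gcongr; linarith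
      calc (1 : ℝ) = x ^ e * x ^ (-e) := by rw [← Real.rpow_add hx]; simp
        _ ≤ _ := by gcongr
    calc D₂ * (1 + x ^ a) ^ 2 ≤ (D₁ + D₂) * (4 * (1 + x) ^ L) := by gcongr; linarith
      _ ≤ (D₁ + D₂) * (4 * (1 + x) ^ L) * (x ^ e * (1 + x) ^ P) :=
          le_mul_of_one_le_right (by positivity) h2
      _ = _ := by rw [pow_add]; ring

lemma abs_le_mul_of_hasDerivAt {φ φ' : ℝ → ℝ} (h : ∀ y, HasDerivAt φ (φ' y) y) (h0 : φ 0 = 0)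
    {y B : ℝ} (hy : 0 ≤ y) (hB : ∀ ξ ∈ Set.Icc 0 y, |φ' ξ| ≤ B) : |φ y| ≤ B * y := by
  have := (convex_Icc 0 y).norm_image_sub_le_of_norm_hasDerivWithin_le
    (fun ξ _ => (h ξ).hasDerivWithinAt) hB (x := 0) (y := y) ⟨le_rfl, hy⟩ ⟨hy, le_rfl⟩
  simpa [h0, abs_of_nonneg hy] using this

lemma symbolBound_two {φ φ' φ'' : ℝ → ℝ} (h1 : ∀ y, HasDerivAt φ (φ' y) y)
    (h2 : ∀ y, HasDerivAt φ' (φ'' y) y) (h0 : φ 0 = 0) (h0' : φ' 0 = 0) {B : ℝ}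
    (hB : ∀ y, |φ'' y| ≤ B) : SymbolBound 2 B φ := by
  have hB0 : 0 ≤ B := (abs_nonneg _).trans (hB 0)
  have b1 : ∀ y ≥ 0, |φ' y| ≤ B * y := fun y hy =>
    abs_le_mul_of_hasDerivAt h2 h0' hy fun ξ _ => hB ξ
  have b0 : ∀ y ≥ 0, |φ y| ≤ B * y * y := fun y hy =>
    abs_le_mul_of_hasDerivAt h1 h0 hy fun ξ hξ => (b1 ξ hξ.1).trans (by gcongr; exact hξ.2)
  refine SymbolBound.of_hasDerivAt (fun x _ => h1 x) (fun x _ => h2 x) (fun x hx => ?_)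
    (fun x hx => ?_) (fun x hx => ?_)
  · refine (b0 x hx.le).trans_eq ?_
    rw [Real.rpow_two]; ring
  · refine (b1 x hx.le).trans_eq ?_
    norm_num
  · simpa using hB x

lemma symbolBound_of_decay {φ φ' φ'' : ℝ → ℝ} (h1 : ∀ y, HasDerivAt φ (φ' y) y)
    (h2 : ∀ y, HasDerivAt φ' (φ'' y) y) {B e : ℝ} {N : ℕ} (he : e ≤ 0) (hN : 2 - e ≤ N)
    (hB : 0 ≤ B) (b0 : ∀ y, |φ y| ≤ B * ((1 + |y|) ^ N)⁻¹)
    (b1 : ∀ y, |φ' y| ≤ B * ((1 + |y|) ^ N)⁻¹) (b2 : ∀ y, |φ'' y| ≤ B * ((1 + |y|) ^ N)⁻¹) :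
    SymbolBound e B φ := by
  have key : ∀ y : ℝ, y > 0 → ∀ d : ℝ, d ≤ 0 → 0 ≤ d + N → ((1 + |y|) ^ N)⁻¹ ≤ y ^ d := by
    intro y hy d hd hd'
    have hy : 0 < y := hy
    rw [abs_of_pos hy, ← neg_neg d, Real.rpow_neg hy.le]
    gcongr
    calc y ^ (-d) ≤ (1 + y) ^ (-d) := Real.rpow_le_rpow hy.le (by linarith) (by linarith)
      _ ≤ (1 + y) ^ (N : ℝ) := Real.rpow_le_rpow_of_exponent_le (by linarith) (by linarith)
      _ = _ := Real.rpow_natCast _ _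
  refine SymbolBound.of_hasDerivAt (fun x _ => h1 x) (fun x _ => h2 x) (fun x hx => ?_)
    (fun x hx => ?_) (fun x hx => ?_)
  · exact (b0 x).trans (by gcongr; exact key x hx _ (by linarith) (by linarith))
  · exact (b1 x).trans (by gcongr; exact key x hx _ (by linarith) (by linarith))
  · exact (b2 x).trans (by gcongr; exact key x hx _ (by linarith) (by linarith))

lemma VanishesToOrder.exists_abs_le_rpow_mul {n : ℕ} {c : ℝ} {g : 𝓢(ℝ × ℝ, ℝ)}
    (h : VanishesToOrder n c g) (h0 : ∀ x, g (x, 0) = 0) (N : ℕ) {e : ℝ} (he : e ≤ n) :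
    ∃ D ≥ 0, ∀ x > 0, ∀ y > 0, |g (c + x, y)| ≤ D * (y * ((1 + y) ^ N)⁻¹) * x ^ e := by
  obtain ⟨D₁, hD₁, H₁⟩ := h.exists_abs_le_rpow N he le_rfl
  obtain ⟨D₂, hD₂, H₂⟩ := h.partialSnd.exists_abs_le_rpow 0 he le_rfl
  simp only [Real.rpow_zero, pow_zero, inv_one, mul_one] at H₁ H₂
  refine ⟨D₁ + 2 ^ N * D₂, by positivity, fun x hx y hy => ?_⟩
  have hx : 0 < x := hx
  have hy : 0 < y := hy
  have hq : ((1 + 1 : ℝ) ^ 2)⁻¹ ≤ 1 := by norm_num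
  rcases le_or_gt 1 y with hy1 | hy1
  · have := H₁ x hx y
    rw [abs_of_pos hy] at this
    refine this.trans ?_
    calc D₁ * x ^ e * ((1 + 1) ^ 2)⁻¹ * ((1 + y) ^ N)⁻¹
        ≤ (D₁ + 2 ^ N * D₂) * x ^ e * 1 * (y * ((1 + y) ^ N)⁻¹) := by
          gcongr
          · have : 0 ≤ 2 ^ N * D₂ := by positivity
            linarith
          · exact le_mul_of_one_le_left (by positivity) hy1
      _ = _ := by ring
  · have hb := abs_le_mul_of_hasDerivAt (fun y => hasDerivAt_partialSnd g (c + x) y) (h0 _) hy.le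
      (B := D₂ * x ^ e) (fun ξ _ => (H₂ x hx ξ).trans (mul_le_of_le_one_right (by positivity) hq))
    refine hb.trans ?_
    have h2 : 1 ≤ 2 ^ N * ((1 + y) ^ N)⁻¹ := by
      rw [← div_eq_mul_inv, one_le_div (by positivity)]
      gcongr; linarith
    calc D₂ * x ^ e * y ≤ D₂ * x ^ e * y * (2 ^ N * ((1 + y) ^ N)⁻¹) :=
          le_mul_of_one_le_right (by positivity) h2
      _ = (2 ^ N * D₂) * (y * ((1 + y) ^ N)⁻¹) * x ^ e := by ring
      _ ≤ _ := by gcongr; linarith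

/-- The integrand of `R` in the coordinates `t = |x - c| ^ α`, `z = s * t + u`. -/
noncomputable def quadrantSymbol (α β c : ℝ) (f : 𝓢(ℝ × ℝ, ℝ)) (t z : ℝ) : ℝ :=
  if 0 < t ∧ 0 < z then
    2 / α * t ^ (1 / α - 1) * ((z ^ (1 / β)) ^ (-1 : ℝ) * f (c + t ^ (1 / α), z ^ (1 / β))) else 0

variable {α β c : ℝ} {f : 𝓢(ℝ × ℝ, ℝ)} {m : ℕ}

lemma quadrantSymbol_of_pos {t z : ℝ} (ht : 0 < t) (hz : 0 < z) : quadrantSymbol α β c f t z =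
    2 / α * t ^ (1 / α - 1) * ((z ^ (1 / β)) ^ (-1 : ℝ) * f (c + t ^ (1 / α), z ^ (1 / β))) :=
  if_pos ⟨ht, hz⟩

lemma partialSnd_eq_zero_of_even (hf : ∀ x y, f (x, -y) = f (x, y)) (x : ℝ) :
    partialSnd f (x, 0) = 0 := by
  have h1 := hasDerivAt_partialSnd f x 0
  have h2 : HasDerivAt (fun y => f (x, -y)) (partialSnd f (x, 0) * -1) 0 := by
    have h3 : HasDerivAt (fun y => f (x, y)) (partialSnd f (x, 0)) (-0) := by simpa using h1
    exact h3.comp 0 (hasDerivAt_neg 0)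
  simp only [hf] at h2
  linarith [h1.unique h2]

lemma exists_symbolBound_right (hα : 1 < α) (hβ : 1 < β) (hm : α - 2 ≤ m)
    (hf : ∀ x y, f (x, -y) = f (x, y)) (h0 : ∀ x, f (x, 0) = 0)
    (hv : VanishesToOrder (m + 1) c f) :
    ∃ C ≥ 0, ∀ t > 0, SymbolBound (1 / β) (C * ((1 + |t|) ^ 2)⁻¹) (quadrantSymbol α β c f t) ∧
      SymbolBound (-2) (C * ((1 + |t|) ^ 2)⁻¹) (quadrantSymbol α β c f t) := by
  have he : α - 1 ≤ ((m + 1 : ℕ) : ℝ) := by push_cast; linarith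
  have hα0 : 0 ≤ α := by linarith
  have hβ0 : 0 < β := by linarith
  set N := ⌈2 * β + 1⌉₊ with hN
  have hN' : 2 * β + 1 ≤ N := Nat.le_ceil _
  obtain ⟨D₀, hD₀, H₀⟩ := hv.exists_abs_le_rpow N he hα0
  obtain ⟨D₁, hD₁, H₁⟩ := hv.partialSnd.exists_abs_le_rpow N he hα0
  obtain ⟨D₂, hD₂, H₂⟩ := hv.partialSnd.partialSnd.exists_abs_le_rpow N he hα0
  refine ⟨2 / α * (2 * (1 + 1 / β) ^ 2 * (9 * (D₀ + D₁ + D₂))), by positivity, fun t ht => ?_⟩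
  have ht : 0 < t := ht
  set x := t ^ (1 / α) with hx
  have hx0 : 0 < x := Real.rpow_pos_of_pos ht _
  have hxα : x ^ α = t := by rw [hx, ← Real.rpow_mul ht.le]; field_simp; simp
  have hxt : t ^ (1 / α - 1) * x ^ (α - 1) = 1 := by
    rw [hx, ← Real.rpow_mul ht.le, ← Real.rpow_add ht]
    have : 1 / α - 1 + 1 / α * (α - 1) = 0 := by field_simp; ring
    rw [this, Real.rpow_zero]
  set B := (D₀ + D₁ + D₂) * x ^ (α - 1) * ((1 + x ^ α) ^ 2)⁻¹ with hB
  have hB0 : 0 ≤ B := by positivity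
  have bd : ∀ D ≤ D₀ + D₁ + D₂, ∀ y : ℝ,
      D * x ^ (α - 1) * ((1 + x ^ α) ^ 2)⁻¹ * ((1 + |y|) ^ N)⁻¹ ≤ B * ((1 + |y|) ^ N)⁻¹ := by
    intro D hD y
    rw [hB]
    gcongr
  have b0 : ∀ y, |f (c + x, y)| ≤ B * ((1 + |y|) ^ N)⁻¹ := fun y =>
    (H₀ x hx0 y).trans (bd _ (by linarith) y)
  have b1 : ∀ y, |partialSnd f (c + x, y)| ≤ B * ((1 + |y|) ^ N)⁻¹ := fun y =>
    (H₁ x hx0 y).trans (bd _ (by linarith) y)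
  have b2 : ∀ y, |partialSnd (partialSnd f) (c + x, y)| ≤ B * ((1 + |y|) ^ N)⁻¹ := fun y =>
    (H₂ x hx0 y).trans (bd _ (by linarith) y)
  have d1 := hasDerivAt_partialSnd f (c + x)
  have d2 := hasDerivAt_partialSnd (partialSnd f) (c + x)
  have S1 : SymbolBound 2 B (fun y => f (c + x, y)) :=
    symbolBound_two d1 d2 (h0 _) (partialSnd_eq_zero_of_even hf _) fun y =>
      (b2 y).trans (mul_le_of_le_one_right hB0 (inv_le_one_of_one_le₀
        (one_le_pow₀ (by linarith [abs_nonneg y]))))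
  have S2 : SymbolBound (1 - 2 * β) B (fun y => f (c + x, y)) :=
    symbolBound_of_decay d1 d2 (by linarith) (by linarith) hB0 b0 b1 b2
  have key : ∀ e e' : ℝ, SymbolBound e B (fun y => f (c + x, y)) → 1 / β * (e + -1) = e' →
      SymbolBound e' (2 / α * (2 * (1 + 1 / β) ^ 2 * (9 * (D₀ + D₁ + D₂))) * ((1 + |t|) ^ 2)⁻¹)
        (quadrantSymbol α β c f t) := by
    rintro e _ S rfl
    have := (((S.rpow_mul (-1)).comp_rpow (p := 1 / β) (by positivity)).const_mul
      (2 / α * t ^ (1 / α - 1))).congr (g := quadrantSymbol α β c f t)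
      fun z hz => quadrantSymbol_of_pos ht hz
    refine this.mono (le_of_eq ?_)
    rw [abs_of_pos (by positivity), abs_of_pos ht, hB, hxα]
    norm_num only [abs_neg, abs_one]
    linear_combination (2 / α * (2 * (1 + 1 / β) ^ 2 * (9 * (D₀ + D₁ + D₂))) *
      ((1 + t) ^ 2)⁻¹) * hxt
  exact ⟨key 2 _ S1 (by norm_num), key _ _ S2 (by field_simp; ring)⟩

lemma exists_symbolBound_left (hα : 1 < α) (hβ : 1 < β) (hm : α - 2 ≤ m)
    (h0 : ∀ x, f (x, 0) = 0) (hv : VanishesToOrder (m + 1) c f) :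
    ∃ C ≥ 0, ∀ z > 0, SymbolBound 0 (C * ((1 + |z|) ^ 2)⁻¹)
      (fun t => quadrantSymbol α β c f t z) := by
  have hα0 : 0 < α := by linarith
  have hβ0 : 0 < β := by linarith
  set N := ⌈2 * β⌉₊ with hN
  have hN' : 2 * β ≤ N := Nat.le_ceil _
  have hz0 : ∀ g : 𝓢(ℝ × ℝ, ℝ), (∀ x, g (x, 0) = 0) → ∀ x, partialFst g (x, 0) = 0 := by
    intro g hg x
    rw [← (hasDerivAt_partialFst g x 0).deriv]
    simp [hg]
  obtain ⟨D₀, hD₀, H₀⟩ := hv.exists_abs_le_rpow_mul h0 N (e := α - 1) (by push_cast; linarith)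
  obtain ⟨D₁, hD₁, H₁⟩ := hv.partialFst.exists_abs_le_rpow_mul (hz0 _ h0) N (e := α - 1 - 1)
    (by simp; linarith)
  obtain ⟨D₂, hD₂, H₂⟩ := hv.partialFst.partialFst.exists_abs_le_rpow_mul (hz0 _ (hz0 _ h0)) N
    (e := α - 1 - 2) (by
      have : (m : ℝ) ≤ ((m + 1 - 1 - 1 : ℕ) : ℝ) + 1 := by norm_cast; omega
      linarith)
  refine ⟨2 / α * (2 * (1 + 1 / α) ^ 2 * ((2 + |1 - α|) ^ 2 * (D₀ + D₁ + D₂))) * 4,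
    by positivity, fun z hz => ?_⟩
  have hz : 0 < z := hz
  set y := z ^ (1 / β) with hy
  have hy0 : 0 < y := Real.rpow_pos_of_pos hz _
  have hyβ : y ^ β = z := by rw [hy, ← Real.rpow_mul hz.le]; field_simp; simp
  set B := (D₀ + D₁ + D₂) * (y * ((1 + y) ^ N)⁻¹) with hB
  have hd : ∀ g : 𝓢(ℝ × ℝ, ℝ), ∀ x, HasDerivAt (fun x => g (c + x, y))
      (partialFst g (c + x, y)) x := fun g x =>
    (hasDerivAt_partialFst g (c + x) y).comp_const_add c x
  have S : SymbolBound (α - 1) B (fun x => f (c + x, y)) := by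
    refine SymbolBound.of_hasDerivAt (fun x _ => hd f x) (fun x _ => hd _ x)
      (fun x hx => (H₀ x hx y hy0).trans ?_) (fun x hx => (H₁ x hx y hy0).trans ?_)
      (fun x hx => (H₂ x hx y hy0).trans ?_) <;>
    · have hx : 0 < x := hx
      rw [hB]
      gcongr
      linarith
  have := (((S.rpow_mul (1 - α)).comp_rpow (p := 1 / α) (by positivity)).const_mul
      (2 / α * y ^ (-1 : ℝ))).congr (g := fun t => quadrantSymbol α β c f t z)
      fun t ht => by
        rw [quadrantSymbol_of_pos ht hz, ← Real.rpow_mul (le_of_lt ht)]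
        have : 1 / α * (1 - α) = 1 / α - 1 := by field_simp
        rw [this]; ring
  have e0 : 1 / α * (α - 1 + (1 - α)) = 0 := by ring
  rw [e0] at this
  refine this.mono ?_
  have h4 : ((1 + y) ^ N)⁻¹ ≤ 4 * ((1 + z) ^ 2)⁻¹ := by
    have := one_add_rpow_sq_le hy0 hβ0.le hN'
    rw [hyβ] at this
    rw [← div_eq_mul_inv, inv_eq_one_div, div_le_div_iff₀ (by positivity) (by positivity)]
    linarith
  rw [abs_of_pos (by positivity), abs_of_pos hz, hB, Real.rpow_neg_one]
  calc 2 / α * y⁻¹ * (2 * (1 + 1 / α) ^ 2 * ((2 + |1 - α|) ^ 2 *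
        ((D₀ + D₁ + D₂) * (y * ((1 + y) ^ N)⁻¹))))
      = 2 / α * (2 * (1 + 1 / α) ^ 2 * ((2 + |1 - α|) ^ 2 * (D₀ + D₁ + D₂))) *
        ((1 + y) ^ N)⁻¹ := by field_simp
    _ ≤ 2 / α * (2 * (1 + 1 / α) ^ 2 * ((2 + |1 - α|) ^ 2 * (D₀ + D₁ + D₂))) *
        (4 * ((1 + z) ^ 2)⁻¹) := by gcongr
    _ = _ := by ring

lemma hasDerivAt_quadrantSymbol {t z : ℝ} (ht : 0 < t) (hz : 0 < z) :
    HasDerivAt (quadrantSymbol α β c f t) (2 / α * t ^ (1 / α - 1) *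
      (-1 * (z ^ (1 / β)) ^ (-1 - 1 : ℝ) * (1 / β * z ^ (1 / β - 1)) *
          f (c + t ^ (1 / α), z ^ (1 / β)) + (z ^ (1 / β)) ^ (-1 : ℝ) *
        (partialSnd f (c + t ^ (1 / α), z ^ (1 / β)) * (1 / β * z ^ (1 / β - 1))))) z := by
  have hy : HasDerivAt (fun z : ℝ => z ^ (1 / β)) (1 / β * z ^ (1 / β - 1)) z :=
    Real.hasDerivAt_rpow_const (Or.inl hz.ne')
  have h1 : HasDerivAt (fun y : ℝ => y ^ (-1 : ℝ)) (-1 * (z ^ (1 / β)) ^ (-1 - 1 : ℝ))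
      (z ^ (1 / β)) := Real.hasDerivAt_rpow_const (Or.inl (by positivity))
  have h2 := hasDerivAt_partialSnd f (c + t ^ (1 / α)) (z ^ (1 / β))
  refine (((h1.comp z hy).mul (h2.comp z hy)).const_mul
    (2 / α * t ^ (1 / α - 1))).congr_of_eventuallyEq ?_
  filter_upwards [Ioi_mem_nhds hz] with w hw using quadrantSymbol_of_pos ht hw

lemma continuousOn_fst_rpow (r : ℝ) :
    ContinuousOn (fun p : ℝ × ℝ => p.1 ^ r) (Set.Ioi 0 ×ˢ Set.Ioi 0) :=
  continuousOn_fst.rpow_const fun _ hp => Or.inl (ne_of_gt hp.1)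

lemma continuousOn_snd_rpow (r : ℝ) :
    ContinuousOn (fun p : ℝ × ℝ => p.2 ^ r) (Set.Ioi 0 ×ˢ Set.Ioi 0) :=
  continuousOn_snd.rpow_const fun _ hp => Or.inl (ne_of_gt hp.2)

lemma continuousOn_comp_rpow (g : 𝓢(ℝ × ℝ, ℝ)) (c p q : ℝ) :
    ContinuousOn (fun x : ℝ × ℝ => g (c + x.1 ^ p, x.2 ^ q)) (Set.Ioi 0 ×ˢ Set.Ioi 0) :=
  g.continuous.comp_continuousOn
    ((continuousOn_const.add (continuousOn_fst_rpow p)).prodMk (continuousOn_snd_rpow q))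

lemma continuousOn_snd_rpow_rpow (r q : ℝ) :
    ContinuousOn (fun p : ℝ × ℝ => (p.2 ^ r) ^ q) (Set.Ioi 0 ×ˢ Set.Ioi 0) :=
  (continuousOn_snd_rpow r).rpow_const fun _ hp => Or.inl (Real.rpow_pos_of_pos hp.2 r).ne'

lemma exists_isQuadrantSymbol (hα : 1 < α) (hβ : 1 < β) (hm : α - 2 ≤ m)
    (hf : ∀ x y, f (x, -y) = f (x, y)) (h0 : ∀ x, f (x, 0) = 0)
    (hv : VanishesToOrder (m + 1) c f) :
    ∃ C, IsQuadrantSymbol (1 / β) C (quadrantSymbol α β c f) := by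
  obtain ⟨C₁, hC₁, H₁⟩ := exists_symbolBound_right hα hβ hm hf h0 hv
  obtain ⟨C₂, hC₂, H₂⟩ := exists_symbolBound_left hα hβ hm h0 hv
  refine ⟨C₁ + C₂, ⟨fun t ht z => if_neg fun h => h.1.not_ge ht,
    fun t z hz => if_neg fun h => h.2.not_ge hz,
    fun t ht => (H₁ t ht).1.mono (by gcongr; linarith),
    fun t ht => (H₁ t ht).2.mono (by gcongr; linarith),
    fun z hz => (H₂ z hz).mono (by gcongr; linarith), ?_, ?_⟩⟩
  · refine ContinuousOn.congr ?_ fun p hp => quadrantSymbol_of_pos hp.1 hp.2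
    exact (continuousOn_const.mul (continuousOn_fst_rpow _)).mul
      ((continuousOn_snd_rpow_rpow _ _).mul (continuousOn_comp_rpow _ _ _ _))
  · refine ContinuousOn.congr ?_ fun p hp => (hasDerivAt_quadrantSymbol hp.1 hp.2).deriv
    have h3 : ContinuousOn (fun p : ℝ × ℝ => 1 / β * p.2 ^ (1 / β - 1))
        (Set.Ioi 0 ×ˢ Set.Ioi 0) := continuousOn_const.mul (continuousOn_snd_rpow _)
    exact (continuousOn_const.mul (continuousOn_fst_rpow _)).mul
      ((((continuousOn_const.mul (continuousOn_snd_rpow_rpow _ _)).mul h3).mul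
        (continuousOn_comp_rpow _ _ _ _)).add ((continuousOn_snd_rpow_rpow _ _).mul
          ((continuousOn_comp_rpow _ _ _ _).mul h3)))

lemma lineInt_quadrantSymbol {α β c : ℝ} {f : 𝓢(ℝ × ℝ, ℝ)} (hα : 0 < α) (s u : ℝ)
    (hx : ∀ x y : ℝ, f (x + c, y) = f (-x + c, y)) :
    lineInt (quadrantSymbol α β c f) s u = ∫ x in {x : ℝ | 0 < s * |x - c| ^ α + u},
        f (x, (s * |x - c| ^ α + u) ^ (1 / β)) / (s * |x - c| ^ α + u) ^ (1 / β) := by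
  have hmeas : MeasurableSet {x : ℝ | 0 < s * |x - c| ^ α + u} :=
    measurableSet_lt measurable_const (by fun_prop)
  set H : ℝ → ℝ := fun r => if 0 < s * r ^ α + u then
    f (c + r, (s * r ^ α + u) ^ (1 / β)) / (s * r ^ α + u) ^ (1 / β) else 0 with hH
  have hfx : ∀ x y : ℝ, f (c + |x|, y) = f (x + c, y) := fun x y => by
    rcases abs_choice x with h | h <;> rw [h, add_comm c]
    exact (hx x y).symm
  have h1 : ∀ x, Set.indicator {x : ℝ | 0 < s * |x - c| ^ α + u} (fun x =>
      f (x, (s * |x - c| ^ α + u) ^ (1 / β)) / (s * |x - c| ^ α + u) ^ (1 / β)) (x + c) =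
      H |x| := fun x => by
    simp only [Set.indicator_apply, Set.mem_ofPred_eq, add_sub_cancel_right, hH, hfx]
  rw [← integral_indicator hmeas, ← integral_add_right_eq_self _ c]
  simp only [h1]
  rw [integral_comp_abs, ← integral_const_mul, lineInt,
    ← setIntegral_eq_integral_of_forall_compl_eq_zero (s := Set.Ioi 0)
      (f := fun t => quadrantSymbol α β c f t (s * t + u)) (fun t ht => if_neg fun h => ht h.1),
    ← integral_comp_rpow_Ioi_of_pos hα]
  refine setIntegral_congr_fun measurableSet_Ioi fun r hr => ?_
  have hr : 0 < r := hr
  have hrα : 0 < r ^ α := by positivity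
  simp only [hH, smul_eq_mul]
  split_ifs with hz
  · rw [quadrantSymbol_of_pos hrα hz, ← Real.rpow_mul hr.le, ← Real.rpow_mul hr.le,
      Real.rpow_neg_one]
    have e1 : α * (1 / α - 1) = 1 - α := by field_simp
    have e2 : α * (1 / α) = 1 := by field_simp
    have e3 : r ^ (α - 1) * r ^ (1 - α) = 1 := by
      rw [← Real.rpow_add hr]; simp
    rw [e1, e2, Real.rpow_one]
    generalize f (c + r, (s * r ^ α + u) ^ (1 / β)) = A
    generalize (s * r ^ α + u) ^ (1 / β) = y
    have e4 := mul_inv_cancel₀ hα.ne'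
    rw [div_eq_mul_inv, div_eq_mul_inv]
    linear_combination (2 * (α * α⁻¹) * (A * y⁻¹)) * e3 + (2 * (A * y⁻¹)) * e4
  · rw [quadrantSymbol, if_neg fun h => hz h.2]
    simp

end

/-- Inversion formula for the generalized hyperbolic Radon transform `R_{α,β}`. -/
theorem Ralphabeta_inversion (α β c : ℝ) (hα : 1 < α) (hβ : 1 < β)
    (m : ℕ) (hm : (m : ℝ) ≥ α - 2)
    (f : SchwartzMap (ℝ × ℝ) ℝ)
    (hsymx : ∀ x y : ℝ, f (x + c, y) = f (-x + c, y))
    (hsymy : ∀ x y : ℝ, f (x + c, y) = f (x + c, -y))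
    (h0 : ∀ x : ℝ, f (x + c, 0) = 0)
    (hvan : ∀ k ≤ m, ∀ y : ℝ, iteratedDeriv k (fun x : ℝ => f (x, y)) c = 0)
    (R : ℝ → ℝ → ℝ)
    (hR : ∀ s u : ℝ, R s u = ∫ x in {x : ℝ | 0 < s * |x - c| ^ α + u},
        f (x, (s * |x - c| ^ α + u) ^ (1 / β)) / (s * |x - c| ^ α + u) ^ (1 / β)) :
    ∀ x y : ℝ, x ≠ c → y ≠ 0 →
      f (x, y) = α * |x - c| ^ (α - 1) * |y| / (4 * Real.pi ^ 2) *
        ∫ s : ℝ, pv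
          (fun u : ℝ => deriv (fun u' : ℝ => R s u') u /
            (|y| ^ β - s * |x - c| ^ α - u))
          (|y| ^ β - s * |x - c| ^ α) := by
  intro x y hx hy
  have hα0 : 0 < α := by linarith
  have hβ0 : 0 < β := by linarith
  have hf : ∀ x y, f (x, -y) = f (x, y) := fun x y => by
    simpa using (hsymy (x - c) y).symm
  have hf0 : ∀ x, f (x, 0) = 0 := fun x => by simpa using h0 (x - c)
  have hv : VanishesToOrder (m + 1) c f := fun k hk y => by
    rw [← iteratedDeriv_fst]
    exact hvan k (by omega) y
  obtain ⟨C, hC⟩ := exists_isQuadrantSymbol hα hβ hm hf hf0 hv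
  have hRF : ∀ s, (fun u' => R s u') = lineInt (quadrantSymbol α β c f) s := fun s => by
    ext u
    rw [hR, lineInt_quadrantSymbol hα0 s u hsymx]
  have hX : 0 < |x - c| := abs_pos.mpr (sub_ne_zero.mpr hx)
  have hY : 0 < |y| := abs_pos.mpr hy
  simp only [hRF]
  rw [hC.integral_pv_deriv_lineInt (by positivity) (by rw [div_lt_one hβ0]; exact hβ)
    (Real.rpow_pos_of_pos hX α) (Real.rpow_pos_of_pos hY β),
    quadrantSymbol_of_pos (Real.rpow_pos_of_pos hX α) (Real.rpow_pos_of_pos hY β),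
    ← Real.rpow_mul hX.le, ← Real.rpow_mul hX.le, ← Real.rpow_mul hY.le, Real.rpow_neg_one]
  have e1 : α * (1 / α - 1) = -(α - 1) := by field_simp; ring
  have e2 : α * (1 / α) = 1 := by field_simp
  have e3 : β * (1 / β) = 1 := by field_simp
  have hfxy : f (c + |x - c|, |y|) = f (x, y) := by
    have h1 : f (c + |x - c|, |y|) = f (x, |y|) := by
      rcases abs_choice (x - c) with h | h <;> rw [h]
      · simp
      · rw [add_comm, ← hsymx]; simp
    rw [h1]
    rcases abs_choice y with h | h <;> rw [h]
    exact hf x y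
  have hXα : |x - c| ^ (α - 1) ≠ 0 := (Real.rpow_pos_of_pos hX _).ne'
  rw [e1, e2, e3, Real.rpow_one, Real.rpow_one, hfxy, Real.rpow_neg hX.le]
  have := Real.pi_ne_zero
  field_simp
  norm_num
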